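/- arXiv:2107.14748 — 2 statements merged into one kernel-verified Lean document; each statement's English description precedes it below -/
import Mathlib

section
/- For every δ > 0 there exist constants C > 0 and T₀ ≥ 3 such that for all T ≥ T₀, ∫_T^{T+δ} |ζ(1+it)|^{−1} dt ≤ C · log log T. -/
open Complex Real Filter MeasureTheory intervalIntegral

/-- `f` and `F` are trigonometric polynomials with the same frequencies such that the coefficients
of `f` are bounded in norm by the (nonnegative) coefficients of `F`. -/
def TrigMajorized (f F : ℝ → ℂ) : Prop :=
  ∃ (ι : Type) (_ : Fintype ι) (a : ι → ℂ) (b ω : ι → ℝ), (∀ j, ‖a j‖ ≤ b j) ∧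
    (∀ t : ℝ, f t = ∑ j, a j * Complex.exp (ω j * t * I)) ∧
    ∀ t : ℝ, F t = ∑ j, (b j : ℂ) * Complex.exp (ω j * t * I)

namespace TrigMajorized

variable {f g F G : ℝ → ℂ}

theorem single {a : ℂ} {b : ℝ} (h : ‖a‖ ≤ b) (ω : ℝ) :
    TrigMajorized (fun t ↦ a * Complex.exp (ω * t * I)) (fun t ↦ b * Complex.exp (ω * t * I)) :=
  ⟨Unit, inferInstance, fun _ ↦ a, fun _ ↦ b, fun _ ↦ ω, by simpa, by simp, by simp⟩

theorem const {a : ℂ} {b : ℝ} (h : ‖a‖ ≤ b) :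
    TrigMajorized (fun _ ↦ a) (fun _ ↦ (b : ℂ)) := by
  simpa using single h 0

theorem add (h : TrigMajorized f F) (h' : TrigMajorized g G) :
    TrigMajorized (fun t ↦ f t + g t) (fun t ↦ F t + G t) := by
  obtain ⟨ι, _, a, b, ω, hab, hf, hF⟩ := h
  obtain ⟨κ, _, a', b', ω', hab', hg, hG⟩ := h'
  refine ⟨ι ⊕ κ, inferInstance, Sum.elim a a', Sum.elim b b', Sum.elim ω ω', ?_, ?_, ?_⟩
  · rintro (j | j) <;> simp [hab, hab']
  · intro t; simp [hf, hg]
  · intro t; simp [hF, hG]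

theorem mul (h : TrigMajorized f F) (h' : TrigMajorized g G) :
    TrigMajorized (fun t ↦ f t * g t) (fun t ↦ F t * G t) := by
  obtain ⟨ι, _, a, b, ω, hab, hf, hF⟩ := h
  obtain ⟨κ, _, a', b', ω', hab', hg, hG⟩ := h'
  refine ⟨ι × κ, inferInstance, fun p ↦ a p.1 * a' p.2, fun p ↦ b p.1 * b' p.2,
    fun p ↦ ω p.1 + ω' p.2, ?_, ?_, ?_⟩
  · rintro ⟨j, k⟩
    rw [norm_mul]
    exact mul_le_mul (hab j) (hab' k) (norm_nonneg _) ((norm_nonneg _).trans (hab j))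
  · intro t
    simp only [hf, hg]
    rw [Finset.sum_mul_sum, Fintype.sum_prod_type]
    refine Finset.sum_congr rfl fun j _ ↦ Finset.sum_congr rfl fun k _ ↦ ?_
    push_cast
    rw [add_mul, add_mul, Complex.exp_add]
    ring
  · intro t
    simp only [hF, hG]
    rw [Finset.sum_mul_sum, Fintype.sum_prod_type]
    refine Finset.sum_congr rfl fun j _ ↦ Finset.sum_congr rfl fun k _ ↦ ?_
    push_cast
    rw [add_mul, add_mul, Complex.exp_add]
    ring

theorem pow (h : TrigMajorized f F) (n : ℕ) :
    TrigMajorized (fun t ↦ f t ^ n) (fun t ↦ F t ^ n) := by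
  induction n with
  | zero => simpa using const (a := 1) (b := 1) (by simp)
  | succ n ih => simpa only [pow_succ] using ih.mul h

theorem sum {f F : ℕ → ℝ → ℂ} (h : ∀ n, TrigMajorized (f n) (F n)) (N : ℕ) :
    TrigMajorized (fun t ↦ ∑ n ∈ Finset.range N, f n t)
      (fun t ↦ ∑ n ∈ Finset.range N, F n t) := by
  induction N with
  | zero => simpa using const (a := 0) (b := 0) (by simp)
  | succ n ih => simpa only [Finset.sum_range_succ] using ih.add (h n)

theorem expSum (h : TrigMajorized f F) (K : ℕ) :
    TrigMajorized (fun t ↦ ∑ k ∈ Finset.range K, f t ^ k / k.factorial)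
      (fun t ↦ ∑ k ∈ Finset.range K, F t ^ k / k.factorial) := by
  refine sum (fun k ↦ ?_) K
  have := (h.pow k).mul (const (a := (k.factorial : ℂ)⁻¹) (b := (k.factorial : ℝ)⁻¹) (by simp))
  simpa [div_eq_mul_inv] using this

theorem continuous_left (h : TrigMajorized f F) : Continuous f := by
  obtain ⟨ι, _, a, b, ω, hab, hf, hF⟩ := h
  rw [funext hf]
  fun_prop

theorem continuous_right (h : TrigMajorized f F) : Continuous F := by
  obtain ⟨ι, _, a, b, ω, hab, hf, hF⟩ := h
  rw [funext hF]
  fun_prop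

end TrigMajorized

theorem integral_sub_mul_cos_nonneg {δ : ℝ} (hδ : 0 < δ) (x : ℝ) :
    0 ≤ ∫ t in (0 : ℝ)..δ, (δ - t) * Real.cos (x * t) := by
  rcases eq_or_ne x 0 with rfl | hx
  · refine intervalIntegral.integral_nonneg hδ.le fun t ht ↦ ?_
    simpa using ht.2
  · have hd : ∀ t ∈ Set.uIcc 0 δ, HasDerivAt
        (fun t ↦ (δ - t) * (Real.sin (x * t) / x) - Real.cos (x * t) / x ^ 2)
        ((δ - t) * Real.cos (x * t)) t := by
      intro t _
      have h1 : HasDerivAt (fun t ↦ x * t) x t := by simpa using (hasDerivAt_id t).const_mul x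
      have h2 := (((hasDerivAt_id t).const_sub δ).mul (h1.sin.div_const x)).sub
        (h1.cos.div_const (x ^ 2))
      refine h2.congr_deriv ?_
      simp only [id]
      field_simp
      ring
    rw [integral_eq_sub_of_hasDerivAt hd (Continuous.intervalIntegrable (by fun_prop) _ _)]
    have : Real.cos (x * δ) / x ^ 2 ≤ 1 / x ^ 2 := by
      gcongr
      exact Real.cos_le_one _
    simpa using this

/-- The Fourier transform of the triangle function is nonnegative. -/
theorem integral_triangle_mul_exp {δ : ℝ} (hδ : 0 < δ) (x : ℝ) :
    ∃ r : ℝ, 0 ≤ r ∧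
      ∫ t in (-δ)..δ, ((δ - |t| : ℝ) : ℂ) * Complex.exp (x * t * I) = r := by
  refine ⟨2 * ∫ t in (0 : ℝ)..δ, (δ - t) * Real.cos (x * t),
    mul_nonneg zero_le_two (integral_sub_mul_cos_nonneg hδ x), ?_⟩
  have hc : Continuous fun t : ℝ ↦ ((δ - |t| : ℝ) : ℂ) * Complex.exp (x * t * I) := by fun_prop
  rw [← integral_add_adjacent_intervals (hc.intervalIntegrable (-δ) 0) (hc.intervalIntegrable 0 δ)]
  have hneg := integral_comp_neg (a := 0) (b := δ)
    (fun t : ℝ ↦ ((δ - |t| : ℝ) : ℂ) * Complex.exp (x * t * I))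
  rw [neg_zero] at hneg
  rw [← hneg, ← intervalIntegral.integral_add (Continuous.intervalIntegrable (by fun_prop) _ _)
    (hc.intervalIntegrable 0 δ), ofReal_mul, ← intervalIntegral.integral_ofReal,
    ← intervalIntegral.integral_const_mul]
  refine intervalIntegral.integral_congr fun t ht ↦ ?_
  rw [Set.uIcc_of_le hδ.le] at ht
  simp only [abs_neg, abs_of_nonneg ht.1, ← mul_add]
  push_cast
  rw [Complex.cos]
  ring_nf

theorem integral_triangle_mul_normSq {δ : ℝ} {ι : Type} [Fintype ι] (a : ι → ℂ) (ω : ι → ℝ)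
    {W : ℝ → ℝ}
    (hW : ∀ x : ℝ, ∫ t in (-δ)..δ, ((δ - |t| : ℝ) : ℂ) * Complex.exp (x * t * I) = W x) :
    ((∫ t in (-δ)..δ, (δ - |t|) * ‖∑ j, a j * Complex.exp (ω j * t * I)‖ ^ 2 : ℝ) : ℂ) =
      ∑ j, ∑ k, a j * starRingEnd ℂ (a k) * W (ω j - ω k) := by
  rw [← intervalIntegral.integral_ofReal]
  simp only [← hW, ← intervalIntegral.integral_const_mul]
  have hi (j k : ι) : IntervalIntegrable (fun t : ℝ ↦ a j * starRingEnd ℂ (a k) *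
      (((δ - |t| : ℝ) : ℂ) * Complex.exp (((ω j - ω k : ℝ) : ℂ) * t * I))) volume (-δ) δ :=
    Continuous.intervalIntegrable (by fun_prop) _ _
  simp only [← intervalIntegral.integral_finsetSum (fun k _ ↦ hi _ k)]
  rw [← intervalIntegral.integral_finsetSum
    (fun j _ ↦ Continuous.intervalIntegrable (by fun_prop) _ _)]
  refine intervalIntegral.integral_congr fun t _ ↦ ?_
  rw [ofReal_mul, ofReal_pow, ← Complex.mul_conj', map_sum, Finset.sum_mul_sum, Finset.mul_sum]
  refine Finset.sum_congr rfl fun j _ ↦ ?_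
  rw [Finset.mul_sum]
  refine Finset.sum_congr rfl fun k _ ↦ ?_
  rw [map_mul, ← Complex.exp_conj]
  simp only [map_mul, conj_ofReal, conj_I, ofReal_sub]
  rw [show ((ω j : ℂ) - ω k) * t * I = ω j * t * I + ω k * t * -I by ring, Complex.exp_add]
  ring

/-- Montgomery's majorant principle for trigonometric polynomials, with the triangle weight. -/
theorem TrigMajorized.integral_le {f F : ℝ → ℂ} (h : TrigMajorized f F) {δ : ℝ} (hδ : 0 < δ) :
    ∫ t in (-δ)..δ, (δ - |t|) * ‖f t‖ ^ 2 ≤ ∫ t in (-δ)..δ, (δ - |t|) * ‖F t‖ ^ 2 := by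
  obtain ⟨ι, _, a, b, ω, hab, hf, hF⟩ := h
  choose W hW0 hW using integral_triangle_mul_exp hδ
  simp only [hf, hF]
  have h1 := integral_triangle_mul_normSq a ω hW
  have h2 := integral_triangle_mul_normSq (fun j ↦ (b j : ℂ)) ω hW
  simp only [conj_ofReal] at h2
  have h3 : (∫ t in (-δ)..δ, (δ - |t|) * ‖∑ j, (b j : ℂ) * Complex.exp (ω j * t * I)‖ ^ 2) =
      ∑ j, ∑ k, b j * b k * W (ω j - ω k) := by exact_mod_cast h2
  rw [h3]
  refine (le_abs_self _).trans ?_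
  rw [← Real.norm_eq_abs, ← Complex.norm_real, h1]
  refine (norm_sum_le _ _).trans (Finset.sum_le_sum fun j _ ↦ (norm_sum_le _ _).trans
    (Finset.sum_le_sum fun k _ ↦ ?_))
  rw [norm_mul, norm_mul, RCLike.norm_conj, Complex.norm_real, Real.norm_of_nonneg (hW0 _)]
  exact mul_le_mul_of_nonneg_right
    (mul_le_mul (hab j) (hab k) (norm_nonneg _) ((norm_nonneg _).trans (hab j))) (hW0 _)

theorem tendsto_integral_triangle_mul_normSq {δ M : ℝ} {f : ℕ → ℝ → ℂ} {g : ℝ → ℂ}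
    (hc : ∀ n, Continuous (f n)) (hM : ∀ n t, ‖f n t‖ ≤ M)
    (hlim : ∀ t, Tendsto (fun n ↦ f n t) atTop (nhds (g t))) :
    Tendsto (fun n ↦ ∫ t in (-δ)..δ, (δ - |t|) * ‖f n t‖ ^ 2) atTop
      (nhds (∫ t in (-δ)..δ, (δ - |t|) * ‖g t‖ ^ 2)) := by
  refine intervalIntegral.tendsto_integral_filter_of_dominated_convergence
    (fun t ↦ |(δ - |t|)| * M ^ 2) (.of_forall fun n ↦ ?_) (.of_forall fun n ↦ .of_forall fun t _ ↦ ?_)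
    (Continuous.intervalIntegrable (by fun_prop) _ _) (.of_forall fun t _ ↦ ?_)
  · have := hc n
    exact Continuous.aestronglyMeasurable (by fun_prop)
  · rw [norm_mul, Real.norm_eq_abs, norm_pow, norm_norm]
    gcongr
    exact hM n t
  · exact ((hlim t).norm.pow 2).const_mul _

theorem norm_expSum_le {z : ℂ} {M : ℝ} (h : ‖z‖ ≤ M) (K : ℕ) :
    ‖∑ k ∈ Finset.range K, z ^ k / k.factorial‖ ≤ Real.exp M := by
  refine (norm_sum_le _ _).trans (le_trans ?_
    (Real.sum_le_exp_of_nonneg ((norm_nonneg z).trans h) K))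
  refine Finset.sum_le_sum fun k _ ↦ ?_
  rw [norm_div, norm_pow, Complex.norm_natCast]
  gcongr

theorem tendsto_expSum (z : ℂ) :
    Tendsto (fun K ↦ ∑ k ∈ Finset.range K, z ^ k / k.factorial) atTop (nhds (Complex.exp z)) := by
  have := NormedSpace.expSeries_div_hasSum_exp (𝔸 := ℂ) z
  rw [← Complex.exp_eq_exp_ℂ] at this
  exact this.tendsto_sum_nat

theorem TrigMajorized.integral_exp_le {f F : ℝ → ℂ} (h : TrigMajorized f F) {δ M : ℝ} (hδ : 0 < δ)
    (hf : ∀ t, ‖f t‖ ≤ M) (hF : ∀ t, ‖F t‖ ≤ M) :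
    ∫ t in (-δ)..δ, (δ - |t|) * ‖Complex.exp (f t)‖ ^ 2 ≤
      ∫ t in (-δ)..δ, (δ - |t|) * ‖Complex.exp (F t)‖ ^ 2 :=
  le_of_tendsto_of_tendsto'
    (tendsto_integral_triangle_mul_normSq (fun K ↦ (h.expSum K).continuous_left)
      (fun K t ↦ norm_expSum_le (hf t) K) fun t ↦ tendsto_expSum (f t))
    (tendsto_integral_triangle_mul_normSq (fun K ↦ (h.expSum K).continuous_right)
      (fun K t ↦ norm_expSum_le (hF t) K) fun t ↦ tendsto_expSum (F t))
    fun K ↦ (h.expSum K).integral_le hδ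

/-- The majorant principle for exponentials of absolutely convergent trigonometric series. -/
theorem integral_exp_tsum_le {u : ℕ → ℂ} {v ω : ℕ → ℝ} (huv : ∀ n, ‖u n‖ ≤ v n)
    (hv : Summable v) {δ : ℝ} (hδ : 0 < δ) :
    ∫ t in (-δ)..δ, (δ - |t|) * ‖Complex.exp (∑' n, u n * Complex.exp (ω n * t * I))‖ ^ 2 ≤
      ∫ t in (-δ)..δ, (δ - |t|) *
        ‖Complex.exp (∑' n, (v n : ℂ) * Complex.exp (ω n * t * I))‖ ^ 2 := by
  have hv0 n : 0 ≤ v n := (norm_nonneg _).trans (huv n)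
  have key {w : ℕ → ℂ} (hw : ∀ n, ‖w n‖ ≤ v n) (t : ℝ) :
      Summable (fun n ↦ w n * Complex.exp (ω n * t * I)) ∧
      ∀ N, ‖∑ n ∈ Finset.range N, w n * Complex.exp (ω n * t * I)‖ ≤ ∑' n, v n := by
    have hb n : ‖w n * Complex.exp (ω n * t * I)‖ ≤ v n := by
      rw [norm_mul, ← ofReal_mul, Complex.norm_exp_ofReal_mul_I, mul_one]
      exact hw n
    exact ⟨.of_norm_bounded hv hb, fun N ↦ (norm_sum_le_of_le _ fun n _ ↦ hb n).trans
      (hv.sum_le_tsum _ fun n _ ↦ hv0 n)⟩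
  have hvv n : ‖(v n : ℂ)‖ ≤ v n := by rw [Complex.norm_real, Real.norm_of_nonneg (hv0 n)]
  have hmaj N := TrigMajorized.sum (fun n ↦ TrigMajorized.single (huv n) (ω n)) N
  have hexp {z : ℂ} {M : ℝ} (h : ‖z‖ ≤ M) : ‖Complex.exp z‖ ≤ Real.exp M := by
    rw [Complex.norm_exp]
    exact Real.exp_le_exp.mpr ((Complex.re_le_norm z).trans h)
  refine le_of_tendsto_of_tendsto'
    (tendsto_integral_triangle_mul_normSq
      (fun N ↦ Complex.continuous_exp.comp (hmaj N).continuous_left)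
      (fun N t ↦ hexp ((key huv t).2 N)) fun t ↦
        (Complex.continuous_exp.tendsto _).comp (key huv t).1.hasSum.tendsto_sum_nat)
    (tendsto_integral_triangle_mul_normSq
      (fun N ↦ Complex.continuous_exp.comp (hmaj N).continuous_right)
      (fun N t ↦ hexp ((key hvv t).2 N)) fun t ↦
        (Complex.continuous_exp.tendsto _).comp (key hvv t).1.hasSum.tendsto_sum_nat)
    fun N ↦ (hmaj N).integral_exp_le hδ (fun t ↦ (key huv t).2 N) (fun t ↦ (key hvv t).2 N)

theorem continuous_riemannZeta_vertical {σ : ℝ} (hσ : 1 < σ) :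
    Continuous fun t : ℝ ↦ riemannZeta (σ + t * I) := by
  refine continuous_iff_continuousAt.mpr fun t ↦ ?_
  refine ContinuousAt.comp (g := riemannZeta) (f := fun t : ℝ ↦ (σ + t * I : ℂ))
    (differentiableAt_riemannZeta fun h ↦ ?_).continuousAt (by fun_prop)
  have := congrArg Complex.re h
  simp at this
  linarith

theorem continuous_inv_norm_riemannZeta_vertical {σ : ℝ} (hσ : 1 < σ) :
    Continuous fun t : ℝ ↦ ‖riemannZeta (σ + t * I)‖⁻¹ :=
  (continuous_riemannZeta_vertical hσ).norm.inv₀ fun t ↦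
    norm_ne_zero_iff.mpr (riemannZeta_ne_zero_of_one_le_re (by simp [hσ.le]))

theorem natCast_cpow_neg_add_mul_I {n : ℕ} (hn : n ≠ 0) (s : ℂ) (t : ℝ) :
    (n : ℂ) ^ (-(s + t * I)) =
      (n : ℂ) ^ (-s) * Complex.exp (((-Real.log n : ℝ) : ℂ) * t * I) := by
  have hn' : (n : ℂ) ≠ 0 := mod_cast hn
  rw [neg_add, Complex.cpow_add _ _ hn', Complex.cpow_def_of_ne_zero hn' (-(t * I)),
    ← Complex.natCast_log]
  congr 2
  push_cast
  ring

open ArithmeticFunction.vonMangoldt in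
/-- Since `|ζ|⁻¹ = |exp (-log ζ / 2)|²`, the majorant principle bounds its local averages on a
vertical line by those of `|ζ| = |exp (log ζ / 2)|²` near the real axis. -/
theorem integral_triangle_inv_zeta_le {δ σ : ℝ} (hδ : 0 < δ) (hσ : 1 < σ) (c : ℝ) :
    ∫ t in (-δ)..δ, (δ - |t|) * ‖riemannZeta (σ + (c + t : ℝ) * I)‖⁻¹ ≤
      ∫ t in (-δ)..δ, (δ - |t|) * ‖riemannZeta (σ + t * I)‖ := by
  set a : ℕ → ℝ := fun n ↦ Λ n / Real.log n with ha
  have ha0 n : 0 ≤ a n := div_nonneg ArithmeticFunction.vonMangoldt_nonneg (Real.log_natCast_nonneg n)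
  have ha1 n : a n ≤ 1 := div_le_one_of_le₀ ArithmeticFunction.vonMangoldt_le_log (Real.log_natCast_nonneg n)
  have haz : a 0 = 0 := by simp [ha]
  have hzeta {s : ℂ} (hs : 1 < s.re) :
      Complex.exp (∑' n, (a n : ℂ) * (n : ℂ) ^ (-s)) = riemannZeta s := by
    rw [← riemannZeta_eq_exp_LSeries hs, LSeries_def₀ (by simp)]
    congr 1
    refine tsum_congr fun n ↦ ?_
    rw [Complex.cpow_neg, ha]
    push_cast
    rfl
  set v : ℕ → ℝ := fun n ↦ 2⁻¹ * (a n * (n : ℝ) ^ (-σ))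
  set u : ℕ → ℂ := fun n ↦ -2⁻¹ * (a n * (n : ℂ) ^ (-(σ + c * I : ℂ)))
  have huv n : ‖u n‖ ≤ v n := by
    rcases eq_or_ne n 0 with rfl | hn
    · simp [u, v, haz]
    · rw [norm_mul, norm_mul, Complex.norm_real, Real.norm_of_nonneg (ha0 n),
        Complex.norm_natCast_cpow_of_pos (Nat.pos_of_ne_zero hn)]
      simp [v]
  have hv : Summable v := by
    refine Summable.mul_left _ (Summable.of_nonneg_of_le (fun n ↦ ?_) (fun n ↦ ?_)
      (Real.summable_nat_rpow.mpr (neg_lt_neg hσ)))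
    · exact mul_nonneg (ha0 n) (by positivity)
    · exact mul_le_of_le_one_left (by positivity) (ha1 n)
  have hre {t : ℝ} : 1 < (σ + t * I : ℂ).re := by simpa
  have hu (t : ℝ) : ‖Complex.exp (∑' n, u n *
      Complex.exp (((-Real.log n : ℝ) : ℂ) * t * I))‖ ^ 2 =
      ‖riemannZeta (σ + (c + t : ℝ) * I)‖⁻¹ := by
    rw [← hzeta hre, ← norm_inv, ← Complex.exp_neg, ← norm_pow, ← Complex.exp_nat_mul,
      ← tsum_mul_left, ← tsum_neg]
    congr 3 with n
    rcases eq_or_ne n 0 with rfl | hn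
    · simp [u, haz]
    · rw [ofReal_add, add_mul, ← add_assoc, natCast_cpow_neg_add_mul_I hn]
      simp only [u]
      push_cast
      ring
  have hvv (t : ℝ) : ‖Complex.exp (∑' n, (v n : ℂ) *
      Complex.exp (((-Real.log n : ℝ) : ℂ) * t * I))‖ ^ 2 =
      ‖riemannZeta (σ + t * I)‖ := by
    rw [← hzeta hre, ← norm_pow, ← Complex.exp_nat_mul, ← tsum_mul_left]
    congr 3 with n
    rcases eq_or_ne n 0 with rfl | hn
    · simp [v, haz]
    · rw [natCast_cpow_neg_add_mul_I hn]
      simp only [v]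
      push_cast [Complex.ofReal_cpow (Nat.cast_nonneg n)]
      ring
  have := integral_exp_tsum_le (ω := fun n ↦ -Real.log n) huv hv hδ
  simpa only [hu, hvv] using this

theorem integral_inv_zeta_le {δ σ : ℝ} (hδ : 0 < δ) (hσ : 1 < σ) (T : ℝ) :
    ∫ t in T..(T + δ), ‖riemannZeta (σ + t * I)‖⁻¹ ≤
      2 * ∫ t in (-δ)..δ, ‖riemannZeta (σ + t * I)‖ := by
  have hc := continuous_inv_norm_riemannZeta_vertical hσ
  have hc' := (continuous_riemannZeta_vertical hσ).norm
  have hcs : Continuous fun t : ℝ ↦ ‖riemannZeta (σ + (T + δ / 2 + t : ℝ) * I)‖⁻¹ :=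
    hc.comp (by fun_prop : Continuous fun t : ℝ ↦ T + δ / 2 + t)
  have hshift := integral_comp_add_left (a := -(δ / 2)) (b := δ / 2)
    (fun t : ℝ ↦ ‖riemannZeta (σ + t * I)‖⁻¹) (T + δ / 2)
  rw [show T + δ / 2 + -(δ / 2) = T by ring, show T + δ / 2 + δ / 2 = T + δ by ring] at hshift
  rw [← hshift]
  have h1 : ∫ t in (-(δ / 2))..(δ / 2), ‖riemannZeta (σ + (T + δ / 2 + t : ℝ) * I)‖⁻¹ ≤
      ∫ t in (-(δ / 2))..(δ / 2), 2 / δ *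
        ((δ - |t|) * ‖riemannZeta (σ + (T + δ / 2 + t : ℝ) * I)‖⁻¹) := by
    refine intervalIntegral.integral_mono_on (by linarith) (hcs.intervalIntegrable _ _)
      (Continuous.intervalIntegrable (by fun_prop) _ _) fun t ht ↦ ?_
    rw [← mul_assoc]
    refine le_mul_of_one_le_left (by positivity) ?_
    have : |t| ≤ δ / 2 := abs_le.mpr ht
    rw [div_mul_eq_mul_div, one_le_div hδ]
    linarith
  have h2 : ∫ t in (-(δ / 2))..(δ / 2), 2 / δ *
        ((δ - |t|) * ‖riemannZeta (σ + (T + δ / 2 + t : ℝ) * I)‖⁻¹) ≤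
      ∫ t in (-δ)..δ, 2 / δ * ((δ - |t|) * ‖riemannZeta (σ + (T + δ / 2 + t : ℝ) * I)‖⁻¹) := by
    refine intervalIntegral.integral_mono_interval (by linarith) (by linarith) (by linarith) ?_
      (Continuous.intervalIntegrable (by fun_prop) _ _)
    refine (ae_restrict_iff' measurableSet_Ioc).mpr (.of_forall fun t ht ↦ ?_)
    have : |t| ≤ δ := abs_le.mpr ⟨ht.1.le, ht.2⟩
    have : 0 ≤ δ - |t| := by linarith
    simp only [Pi.zero_apply]
    positivity
  have h3 : ∫ t in (-δ)..δ, (δ - |t|) * ‖riemannZeta (σ + t * I)‖ ≤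
      ∫ t in (-δ)..δ, δ * ‖riemannZeta (σ + t * I)‖ := by
    refine intervalIntegral.integral_mono_on (by linarith)
      (Continuous.intervalIntegrable (by fun_prop) _ _)
      (Continuous.intervalIntegrable (by fun_prop) _ _) fun t ht ↦ ?_
    gcongr
    linarith [abs_nonneg t]
  refine h1.trans (h2.trans ?_)
  rw [intervalIntegral.integral_const_mul]
  refine (mul_le_mul_of_nonneg_left
    ((integral_triangle_inv_zeta_le hδ hσ _).trans h3) (by positivity)).trans_eq ?_
  rw [intervalIntegral.integral_const_mul, ← mul_assoc, div_mul_cancel₀ _ hδ.ne']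

theorem norm_ofReal_cpow_neg_sub_le {s : ℂ} (hs : 1 ≤ s.re) {a : ℝ} (ha : 1 ≤ a) {x y : ℝ}
    (hax : a ≤ x) (hxy : x ≤ y) :
    ‖(y : ℂ) ^ (-s) - (x : ℂ) ^ (-s)‖ ≤ ‖s‖ / a ^ 2 * (y - x) := by
  have hs0 : -s ≠ 0 := by
    intro h
    rw [neg_eq_zero.mp h] at hs
    norm_num at hs
  refine norm_image_sub_le_of_norm_deriv_le_segment' (f := fun x : ℝ ↦ (x : ℂ) ^ (-s))
    (f' := fun x ↦ -s * (x : ℂ) ^ (-s - 1))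
    (fun z hz ↦ (hasDerivAt_ofReal_cpow_const (by linarith [hz.1]) hs0).hasDerivWithinAt)
    (fun z hz ↦ ?_) y (Set.right_mem_Icc.mpr hxy)
  have haz : a ≤ z := hax.trans hz.1
  rw [norm_mul, norm_neg, Complex.norm_cpow_eq_rpow_re_of_pos (by linarith), div_eq_mul_inv]
  gcongr
  calc z ^ (-s - 1).re ≤ z ^ (-2 : ℝ) := by
        refine Real.rpow_le_rpow_of_exponent_le (ha.trans haz) ?_
        simp only [sub_re, neg_re, one_re]
        linarith
    _ ≤ a ^ (-2 : ℝ) := Real.rpow_le_rpow_of_nonpos (by linarith) haz (by norm_num)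
    _ = (a ^ 2)⁻¹ := by
        rw [Real.rpow_neg (by linarith)]
        norm_cast

theorem norm_cpow_neg_sub_integral_le {s : ℂ} (hs : 1 ≤ s.re) (hs1 : s ≠ 1) {a : ℝ} (ha : 1 ≤ a) :
    ‖((a + 1 : ℝ) : ℂ) ^ (-s) - ((a : ℂ) ^ (1 - s) - ((a + 1 : ℝ) : ℂ) ^ (1 - s)) / (s - 1)‖ ≤
      ‖s‖ / a ^ 2 := by
  have hs2 : 1 - s ≠ 0 := sub_ne_zero.mpr hs1.symm
  have h := norm_image_sub_le_of_norm_deriv_le_segment'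
    (f := fun x : ℝ ↦ (x : ℂ) ^ (1 - s) / (1 - s) - ((a + 1 : ℝ) : ℂ) ^ (-s) * x)
    (f' := fun x ↦ (x : ℂ) ^ (-s) - ((a + 1 : ℝ) : ℂ) ^ (-s)) (a := a) (b := a + 1)
    (C := ‖s‖ / a ^ 2) (fun z hz ↦ ?_) (fun z hz ↦ ?_) (a + 1) (Set.right_mem_Icc.mpr (by linarith))
  · rw [add_sub_cancel_left, mul_one, ← norm_neg] at h
    refine le_trans (le_of_eq ?_) h
    congr 1
    rw [← neg_sub 1 s, div_neg]
    push_cast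
    ring
  · have h1 := (hasDerivAt_ofReal_cpow_const (x := z) (by linarith [hz.1]) hs2).div_const (1 - s)
    have h2 := (hasDerivAt_id z).ofReal_comp.const_mul (((a + 1 : ℝ) : ℂ) ^ (-s))
    refine ((h1.sub h2).congr_deriv ?_).hasDerivWithinAt
    rw [mul_div_cancel_left₀ _ hs2]
    simp
  · rw [norm_sub_rev]
    refine (norm_ofReal_cpow_neg_sub_le hs ha hz.1 hz.2.le).trans ?_
    exact mul_le_of_le_one_right (by positivity) (by linarith [hz.1])

theorem norm_sum_sub_sum_sub_le {s : ℂ} (hs : 1 ≤ s.re) (hs1 : s ≠ 1) {N M : ℕ} (hN : 1 ≤ N)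
    (hNM : N ≤ M) :
    ‖∑ n ∈ Finset.range M, ((n : ℂ) + 1) ^ (-s) - ∑ n ∈ Finset.range N, ((n : ℂ) + 1) ^ (-s) -
      ((N : ℂ) ^ (1 - s) - (M : ℂ) ^ (1 - s)) / (s - 1)‖ ≤ 2 * ‖s‖ * (1 / N - 1 / M) := by
  induction M, hNM using Nat.le_induction with
  | base => simp
  | succ M hM ih =>
    have hM1 : (1 : ℝ) ≤ M := by exact_mod_cast hN.trans hM
    have h := norm_cpow_neg_sub_integral_le hs hs1 hM1
    push_cast at h ⊢
    rw [Finset.sum_range_succ]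
    refine le_trans (le_of_eq ?_) ((norm_add_le_of_le ih h).trans ?_)
    · congr 1
      ring
    · have : 1 / (M : ℝ) ^ 2 ≤ 2 * (1 / M - 1 / (M + 1)) := by
        rw [div_sub_div _ _ (by positivity) (by positivity), mul_div_assoc',
          div_le_div_iff₀ (by positivity) (by positivity)]
        nlinarith
      have := mul_le_mul_of_nonneg_left this (norm_nonneg s)
      rw [div_eq_mul_one_div ‖s‖]
      linarith

/-- The truncated Dirichlet series approximation to `ζ` to the right of the line `re s = 1`. -/
theorem norm_zeta_sub_sum_sub_le {s : ℂ} (hs : 1 < s.re) {N : ℕ} (hN : 1 ≤ N) :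
    ‖riemannZeta s - ∑ n ∈ Finset.range N, ((n : ℂ) + 1) ^ (-s) -
      (N : ℂ) ^ (1 - s) / (s - 1)‖ ≤ 2 * ‖s‖ / N := by
  have hs1 : s ≠ 1 := by
    rintro rfl
    norm_num at hs
  have hsum : HasSum (fun n : ℕ ↦ ((n : ℂ) + 1) ^ (-s)) (riemannZeta s) := by
    have h := (Complex.summable_one_div_nat_cpow.mpr hs).comp_injective (add_left_injective 1)
    rw [zeta_eq_tsum_one_div_nat_add_one_cpow hs]
    simpa [Function.comp_def, Complex.cpow_neg] using h.hasSum
  have hlim : Tendsto (fun M : ℕ ↦ (M : ℂ) ^ (1 - s)) atTop (nhds 0) := by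
    rw [tendsto_zero_iff_norm_tendsto_zero]
    have : Tendsto (fun M : ℕ ↦ (M : ℝ) ^ (-(s.re - 1))) atTop (nhds 0) :=
      (tendsto_rpow_neg_atTop (by linarith)).comp tendsto_natCast_atTop_atTop
    refine this.congr' ?_
    filter_upwards [eventually_gt_atTop 0] with M hM
    rw [Complex.norm_natCast_cpow_of_pos hM]
    simp
  have h := ((((hsum.tendsto_sum_nat.sub_const (∑ n ∈ Finset.range N, ((n : ℂ) + 1) ^ (-s))).sub
    ((hlim.const_sub ((N : ℂ) ^ (1 - s))).div_const (s - 1)))).norm)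
  rw [sub_zero] at h
  refine le_of_tendsto h ?_
  filter_upwards [eventually_ge_atTop N] with M hM
  refine (norm_sum_sub_sum_sub_le hs.le hs1 hN hM).trans ?_
  rw [div_eq_mul_one_div (2 * ‖s‖)]
  refine mul_le_mul_of_nonneg_left ?_ (by positivity)
  have : (0 : ℝ) ≤ 1 / M := by positivity
  linarith

theorem norm_zeta_sub_sum_le_of_one_lt {σ t : ℝ} (hσ : 1 < σ) (hσ2 : σ ≤ 2) (ht : 1 ≤ t) {N : ℕ}
    (hN : t ^ 2 ≤ N) :
    ‖riemannZeta (σ + t * I) - ∑ n ∈ Finset.range N, ((n : ℂ) + 1) ^ (-(σ + t * I : ℂ))‖ ≤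
      7 / t := by
  have hN1 : 1 ≤ N := by
    have : (1 : ℝ) ≤ N := by nlinarith
    exact_mod_cast this
  have h := norm_zeta_sub_sum_sub_le (s := σ + t * I) (by simpa) hN1
  have h1 : ‖(N : ℂ) ^ (1 - (σ + t * I : ℂ)) / (σ + t * I - 1)‖ ≤ 1 / t := by
    rw [norm_div, Complex.norm_natCast_cpow_of_pos (by lia)]
    refine div_le_div₀ zero_le_one ?_ (by linarith) ?_
    · exact Real.rpow_le_one_of_one_le_of_nonpos (by exact_mod_cast hN1) (by simp [hσ.le])
    · have := (le_abs_self _).trans (Complex.abs_im_le_norm (σ + t * I - 1 : ℂ))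
      simpa using this
  have h2 : ‖(σ + t * I : ℂ)‖ ≤ 3 * t := by
    refine (norm_add_le _ _).trans ?_
    rw [norm_mul, Complex.norm_I, Complex.norm_real, Complex.norm_real,
      Real.norm_of_nonneg (by linarith), Real.norm_of_nonneg (by linarith)]
    linarith
  have h3 : 2 * ‖(σ + t * I : ℂ)‖ / N ≤ 6 / t := by
    refine (div_le_div₀ (by positivity) (mul_le_mul_of_nonneg_left h2 zero_le_two)
      (by positivity) hN).trans_eq ?_
    field_simp
    norm_num
  calc _ ≤ _ := norm_le_norm_sub_add _ ((N : ℂ) ^ (1 - (σ + t * I : ℂ)) / (σ + t * I - 1))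
    _ ≤ 6 / t + 1 / t := add_le_add (h.trans h3) h1
    _ = 7 / t := by ring

theorem norm_zeta_sub_sum_le {σ t : ℝ} (hσ : 1 ≤ σ) (hσ2 : σ ≤ 2) (ht : 1 ≤ t) {N : ℕ}
    (hN : t ^ 2 ≤ N) :
    ‖riemannZeta (σ + t * I) - ∑ n ∈ Finset.range N, ((n : ℂ) + 1) ^ (-(σ + t * I : ℂ))‖ ≤
      7 / t := by
  rcases hσ.eq_or_lt with rfl | hσ
  · have hne (n : ℕ) : (n : ℂ) + 1 ≠ 0 := Nat.cast_add_one_ne_zero n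
    have hc : ContinuousAt (fun σ : ℝ ↦ ‖riemannZeta (σ + t * I) -
        ∑ n ∈ Finset.range N, ((n : ℂ) + 1) ^ (-(σ + t * I : ℂ))‖) 1 := by
      refine (ContinuousAt.sub (ContinuousAt.comp (g := riemannZeta)
        (f := fun σ : ℝ ↦ (σ + t * I : ℂ)) (differentiableAt_riemannZeta fun h ↦ ?_).continuousAt
        (by fun_prop)) ?_).norm
      · have := congrArg Complex.im h
        simp at this
        linarith
      · refine Continuous.continuousAt (continuous_finsetSum _ fun n _ ↦ ?_)
        exact Continuous.const_cpow (by fun_prop) (.inl (hne n))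
    refine le_of_tendsto (hc.tendsto.mono_left (nhdsWithin_le_nhds (s := Set.Ioi 1))) ?_
    filter_upwards [Ioc_mem_nhdsGT (show (1 : ℝ) < 2 by norm_num)] with σ hσ
    exact norm_zeta_sub_sum_le_of_one_lt hσ.1 hσ.2 ht hN
  · exact norm_zeta_sub_sum_le_of_one_lt hσ hσ2 ht hN

theorem norm_natCast_add_one_cpow_neg (n : ℕ) (σ t : ℝ) :
    ‖((n : ℂ) + 1) ^ (-(σ + t * I : ℂ))‖ = ((n : ℝ) + 1) ^ (-σ) := by
  have := Complex.norm_natCast_cpow_of_pos (Nat.succ_pos n) (-(σ + t * I : ℂ))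
  push_cast at this
  simpa using this

theorem sum_inv_le_one_add_log (N : ℕ) :
    ∑ n ∈ Finset.range N, ((n : ℝ) + 1)⁻¹ ≤ 1 + Real.log N := by
  have := harmonic_le_one_add_log N
  simpa [harmonic] using this

theorem exists_nat_sq_le_log_le {t : ℝ} (ht : 3 ≤ t) :
    ∃ N : ℕ, t ^ 2 ≤ N ∧ Real.log N ≤ 3 * Real.log t := by
  refine ⟨⌈t ^ 2⌉₊, Nat.le_ceil _, ?_⟩
  have h := (Nat.ceil_lt_add_one (sq_nonneg t)).le
  have h' := Nat.le_ceil (t ^ 2)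
  have h0 : (0 : ℝ) < ⌈t ^ 2⌉₊ := lt_of_lt_of_le (by positivity) h'
  refine (Real.log_le_log h0 (show (⌈t ^ 2⌉₊ : ℝ) ≤ t ^ 3 by nlinarith)).trans_eq ?_
  rw [Real.log_pow]
  norm_num

theorem one_le_log_of_three_le {t : ℝ} (ht : 3 ≤ t) : 1 ≤ Real.log t :=
  (Real.le_log_iff_exp_le (by linarith)).mpr (by linarith [Real.exp_one_lt_d9])

theorem norm_zeta_le_log {σ t : ℝ} (hσ : 1 ≤ σ) (hσ2 : σ ≤ 2) (ht : 3 ≤ t) :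
    ‖riemannZeta (σ + t * I)‖ ≤ 7 * Real.log t := by
  obtain ⟨N, hN, hlog⟩ := exists_nat_sq_le_log_le ht
  have h1 := norm_zeta_sub_sum_le hσ hσ2 (by linarith) hN
  have h2 : ‖∑ n ∈ Finset.range N, ((n : ℂ) + 1) ^ (-(σ + t * I : ℂ))‖ ≤ 1 + Real.log N := by
    refine (norm_sum_le_of_le _ fun n _ ↦ ?_).trans (sum_inv_le_one_add_log N)
    rw [norm_natCast_add_one_cpow_neg, ← Real.rpow_neg_one]
    exact Real.rpow_le_rpow_of_exponent_le (by linarith [n.cast_nonneg (α := ℝ)]) (by linarith)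
  have h3 : 7 / t ≤ 7 / 3 := by gcongr
  have h4 := norm_le_norm_sub_add (riemannZeta (σ + t * I))
    (∑ n ∈ Finset.range N, ((n : ℂ) + 1) ^ (-(σ + t * I : ℂ)))
  linarith [one_le_log_of_three_le ht]

theorem norm_zeta_sub_zeta_le {ε t : ℝ} (hε : 0 < ε) (hε1 : ε ≤ 1) (ht : 3 ≤ t) :
    ‖riemannZeta ((1 + ε : ℝ) + t * I) - riemannZeta ((1 : ℝ) + t * I)‖ ≤
      12 * ε * Real.log t ^ 2 + 14 / t := by
  obtain ⟨N, hN, hlog⟩ := exists_nat_sq_le_log_le ht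
  have hl := one_le_log_of_three_le ht
  have h1 := norm_zeta_sub_sum_le (σ := 1 + ε) (by linarith) (by linarith) (by linarith) hN
  have h2 := norm_zeta_sub_sum_le (σ := 1) le_rfl one_le_two (by linarith) hN
  have h3 : ‖∑ n ∈ Finset.range N, ((n : ℂ) + 1) ^ (-((1 + ε : ℝ) + t * I : ℂ)) -
      ∑ n ∈ Finset.range N, ((n : ℂ) + 1) ^ (-((1 : ℝ) + t * I : ℂ))‖ ≤
      ε * Real.log N * (1 + Real.log N) := by
    have hlN : 0 ≤ Real.log N := Real.log_natCast_nonneg N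
    rw [← Finset.sum_sub_distrib]
    refine le_trans (norm_sum_le_of_le (n := fun n : ℕ ↦ ε * Real.log N * ((n : ℝ) + 1)⁻¹) _
      fun n hn ↦ ?_) ?_
    · have hn0 : (0 : ℝ) < (n : ℝ) + 1 := by positivity
      have hne : (n : ℂ) + 1 ≠ 0 := Nat.cast_add_one_ne_zero n
      have hd : ((n : ℂ) + 1) ^ (-((1 + ε : ℝ) + t * I : ℂ)) -
          ((n : ℂ) + 1) ^ (-((1 : ℝ) + t * I : ℂ)) =
          ((n : ℂ) + 1) ^ (-((1 : ℝ) + t * I : ℂ)) * (((((n : ℝ) + 1) ^ (-ε) - 1 : ℝ)) : ℂ) := by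
        rw [ofReal_sub, Complex.ofReal_cpow hn0.le, mul_sub]
        push_cast
        rw [← Complex.cpow_add _ _ hne]
        ring_nf
      rw [hd, norm_mul, norm_natCast_add_one_cpow_neg, Complex.norm_real, Real.norm_eq_abs,
        abs_sub_comm, Real.rpow_neg_one, mul_comm]
      gcongr
      have hle : Real.log ((n : ℝ) + 1) ≤ Real.log N := by
        refine Real.log_le_log hn0 ?_
        exact_mod_cast Finset.mem_range.mp hn
      have hle1 : ((n : ℝ) + 1) ^ (-ε) ≤ 1 :=
        Real.rpow_le_one_of_one_le_of_nonpos (by linarith [n.cast_nonneg (α := ℝ)]) (by linarith)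
      rw [abs_of_nonneg (by linarith), Real.rpow_def_of_pos hn0]
      have := Real.add_one_le_exp (Real.log ((n : ℝ) + 1) * -ε)
      nlinarith
    · rw [← Finset.mul_sum]
      exact mul_le_mul_of_nonneg_left (sum_inv_le_one_add_log N) (by positivity)
  have h4 : ε * Real.log N * (1 + Real.log N) ≤ 12 * ε * Real.log t ^ 2 := by
    have : ε * Real.log N * (1 + Real.log N) ≤
        ε * (3 * Real.log t) * (Real.log t + 3 * Real.log t) := by gcongr
    linarith
  rw [norm_sub_rev] at h2
  have h5 := norm_add₃_le (a := riemannZeta ((1 + ε : ℝ) + t * I) -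
      ∑ n ∈ Finset.range N, ((n : ℂ) + 1) ^ (-((1 + ε : ℝ) + t * I : ℂ)))
    (b := ∑ n ∈ Finset.range N, ((n : ℂ) + 1) ^ (-((1 + ε : ℝ) + t * I : ℂ)) -
      ∑ n ∈ Finset.range N, ((n : ℂ) + 1) ^ (-((1 : ℝ) + t * I : ℂ)))
    (c := ∑ n ∈ Finset.range N, ((n : ℂ) + 1) ^ (-((1 : ℝ) + t * I : ℂ)) -
      riemannZeta ((1 : ℝ) + t * I))
  rw [sub_add_sub_cancel, sub_add_sub_cancel] at h5
  have h6 : 7 / t + 7 / t = 14 / t := by ring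
  linarith

theorem norm_zeta_le_inv_add {s : ℂ} (hs : 1 < s.re) :
    ‖riemannZeta s‖ ≤ ‖s - 1‖⁻¹ + 1 + 2 * ‖s‖ := by
  have h := norm_zeta_sub_sum_sub_le hs le_rfl
  simp only [Finset.range_one, Finset.sum_singleton, Nat.cast_zero, zero_add, Nat.cast_one,
    Complex.one_cpow, div_one] at h
  have h1 := norm_add₃_le (a := riemannZeta s - 1 - 1 / (s - 1)) (b := 1) (c := 1 / (s - 1))
  rw [show riemannZeta s - 1 - 1 / (s - 1) + 1 + 1 / (s - 1) = riemannZeta s by ring, norm_one,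
    norm_div _ (s - 1), norm_one] at h1
  rw [inv_eq_one_div]
  linarith

theorem one_le_norm_zeta_product {ε : ℝ} (hε : 0 < ε) (t : ℝ) :
    1 ≤ ‖riemannZeta (1 + ε : ℝ)‖ ^ 3 * ‖riemannZeta ((1 + ε : ℝ) + t * I)‖ ^ 4 *
      ‖riemannZeta ((1 + ε : ℝ) + (2 * t : ℝ) * I)‖ := by
  have h := DirichletCharacter.norm_LFunction_product_ge_one (1 : DirichletCharacter ℂ 1) hε t
  simp only [DirichletCharacter.LFunctionTrivChar, DirichletCharacter.LFunction_modOne_eq,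
    norm_mul, norm_pow] at h
  push_cast
  rw [mul_comm (t : ℂ) I, mul_right_comm (2 : ℂ) t I]
  exact h

theorem le_norm_zeta_pow_four {ε t : ℝ} (hε : 0 < ε) (hε1 : ε ≤ 1) (ht : 3 ≤ t) :
    ε ^ 3 ≤ 3024 * Real.log t * ‖riemannZeta ((1 + ε : ℝ) + t * I)‖ ^ 4 := by
  have h := one_le_norm_zeta_product hε t
  have h1 : ‖riemannZeta (1 + ε : ℝ)‖ ≤ 6 / ε := by
    have h' := norm_zeta_le_inv_add (s := (1 + ε : ℝ)) (by simpa)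
    rw [Complex.norm_real, ofReal_add, ofReal_one, add_sub_cancel_left, Complex.norm_real,
      Real.norm_of_nonneg hε.le, Real.norm_of_nonneg (by linarith)] at h'
    have h1e : 1 ≤ ε⁻¹ := (one_le_inv₀ hε).mpr hε1
    rw [div_eq_mul_inv]
    push_cast
    linarith
  have h2 : ‖riemannZeta ((1 + ε : ℝ) + (2 * t : ℝ) * I)‖ ≤ 14 * Real.log t := by
    have h' := norm_zeta_le_log (σ := 1 + ε) (t := 2 * t) (by linarith) (by linarith) (by linarith)
    have : Real.log (2 * t) ≤ 2 * Real.log t := by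
      rw [Real.log_mul (by norm_num) (by linarith)]
      have := Real.log_le_log two_pos (show 2 ≤ t by linarith)
      linarith
    linarith
  have hl := one_le_log_of_three_le ht
  have h3 : 1 ≤ (6 / ε) ^ 3 * ‖riemannZeta ((1 + ε : ℝ) + t * I)‖ ^ 4 * (14 * Real.log t) :=
    h.trans (by gcongr)
  have h4 := mul_le_mul_of_nonneg_left h3 (pow_pos hε 3).le
  rw [mul_one] at h4
  refine h4.trans_eq ?_
  field_simp
  ring

theorem inv_norm_zeta_le_two_mul {ε l t : ℝ} (hε : 0 < ε) (hε1 : ε ≤ 1) (hl : 1 ≤ l)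
    (ht : 3 ≤ t) (hlog : Real.log t ≤ 2 * l) (htε : 1 / t ≤ ε)
    (hK : 6048 * 124 ^ 4 * (ε * l ^ 9) ≤ 1) :
    ‖riemannZeta ((1 : ℝ) + t * I)‖⁻¹ ≤ 2 * ‖riemannZeta ((1 + ε : ℝ) + t * I)‖⁻¹ := by
  have h1 := norm_zeta_sub_zeta_le hε hε1 ht
  have h2 := le_norm_zeta_pow_four hε hε1 ht
  have h3 := norm_sub_norm_le (riemannZeta ((1 + ε : ℝ) + t * I)) (riemannZeta ((1 : ℝ) + t * I))
  set z := ‖riemannZeta ((1 + ε : ℝ) + t * I)‖ with hz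
  have hz0 : 0 < z := norm_pos_iff.mpr
    (riemannZeta_ne_zero_of_one_le_re (by simpa using hε.le))
  have hlt := one_le_log_of_three_le ht
  have hD : 12 * ε * Real.log t ^ 2 + 14 / t ≤ 62 * ε * l ^ 2 := by
    have ha : 12 * ε * Real.log t ^ 2 ≤ 12 * ε * (2 * l) ^ 2 := by gcongr
    have hb : 14 / t ≤ 14 * (ε * l ^ 2) := by
      rw [div_eq_mul_one_div]
      gcongr
      exact htε.trans (le_mul_of_one_le_right hε.le (one_le_pow₀ hl))
    linarith
  have hpow : (124 * ε * l ^ 2) ^ 4 ≤ z ^ 4 := by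
    have ha : 6048 * l * (124 * ε * l ^ 2) ^ 4 ≤ 6048 * l * z ^ 4 := by
      calc 6048 * l * (124 * ε * l ^ 2) ^ 4 = ε ^ 3 * (6048 * 124 ^ 4 * (ε * l ^ 9)) := by ring
        _ ≤ ε ^ 3 * 1 := by gcongr
        _ ≤ 3024 * Real.log t * z ^ 4 := by rwa [mul_one]
        _ ≤ 3024 * (2 * l) * z ^ 4 := by gcongr
        _ = 6048 * l * z ^ 4 := by ring
    exact le_of_mul_le_mul_left ha (by positivity)
  have hle : 124 * ε * l ^ 2 ≤ z := (pow_le_pow_iff_left₀ (by positivity) hz0.le (by norm_num)).mp hpow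
  calc ‖riemannZeta ((1 : ℝ) + t * I)‖⁻¹ ≤ (z / 2)⁻¹ := by
        gcongr
        linarith
    _ = 2 * z⁻¹ := by rw [inv_div, div_eq_mul_inv]

theorem norm_zeta_le_two_div_add {ε δ t : ℝ} (hε : 0 < ε) (hε1 : ε ≤ 1) (ht : |t| ≤ δ) :
    ‖riemannZeta ((1 + ε : ℝ) + t * I)‖ ≤ 2 * (ε + |t|)⁻¹ + (5 + 2 * δ) := by
  have h := norm_zeta_le_inv_add (s := (1 + ε : ℝ) + t * I) (by simpa using hε)
  have h1 : ((1 + ε : ℝ) + t * I : ℂ) - 1 = ε + t * I := by push_cast; ring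
  rw [h1] at h
  have h2 : (ε + |t|) / 2 ≤ ‖(ε + t * I : ℂ)‖ := by
    have ha := Complex.abs_re_le_norm (ε + t * I)
    have hb := Complex.abs_im_le_norm (ε + t * I)
    simp at ha hb
    linarith [le_abs_self ε]
  have h3 : ‖((1 + ε : ℝ) + t * I : ℂ)‖ ≤ 2 + δ := by
    refine (norm_add_le _ _).trans ?_
    rw [norm_mul, Complex.norm_I, mul_one, Complex.norm_real, Complex.norm_real,
      Real.norm_of_nonneg (by linarith), Real.norm_eq_abs]
    linarith
  have h4 : ‖(ε + t * I : ℂ)‖⁻¹ ≤ ((ε + |t|) / 2)⁻¹ := by gcongr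
  rw [inv_div, div_eq_mul_inv] at h4
  linarith

theorem integral_inv_add_abs {ε δ : ℝ} (hε : 0 < ε) (hδ : 0 < δ) :
    ∫ t in (-δ)..δ, (ε + |t|)⁻¹ = 2 * Real.log ((ε + δ) / ε) := by
  have hc : Continuous fun t : ℝ ↦ (ε + |t|)⁻¹ :=
    Continuous.inv₀ (by fun_prop) fun t ↦ by positivity
  have hneg := integral_comp_neg (a := 0) (b := δ) (fun t : ℝ ↦ (ε + |t|)⁻¹)
  simp only [neg_zero, abs_neg] at hneg
  rw [← integral_add_adjacent_intervals (hc.intervalIntegrable (-δ) 0) (hc.intervalIntegrable 0 δ),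
    ← hneg, ← two_mul]
  congr 1
  calc ∫ t in (0 : ℝ)..δ, (ε + |t|)⁻¹ = ∫ t in (0 : ℝ)..δ, (ε + t)⁻¹ :=
        intervalIntegral.integral_congr fun t ht ↦ by
          rw [Set.uIcc_of_le hδ.le] at ht
          simp only [abs_of_nonneg ht.1]
    _ = ∫ t in (ε + 0)..(ε + δ), t⁻¹ := integral_comp_add_left (fun t : ℝ ↦ t⁻¹) ε
    _ = Real.log ((ε + δ) / ε) := by
      rw [add_zero, integral_inv_of_pos hε (by linarith)]

theorem integral_norm_zeta_near_one_le {ε δ : ℝ} (hε : 0 < ε) (hε1 : ε ≤ 1) (hδ : 0 < δ) :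
    ∫ t in (-δ)..δ, ‖riemannZeta ((1 + ε : ℝ) + t * I)‖ ≤
      4 * Real.log ((ε + δ) / ε) + 2 * δ * (5 + 2 * δ) := by
  have hc : Continuous fun t : ℝ ↦ (ε + |t|)⁻¹ :=
    Continuous.inv₀ (by fun_prop) fun t ↦ by positivity
  calc ∫ t in (-δ)..δ, ‖riemannZeta ((1 + ε : ℝ) + t * I)‖
      ≤ ∫ t in (-δ)..δ, (2 * (ε + |t|)⁻¹ + (5 + 2 * δ)) :=
        intervalIntegral.integral_mono_on (by linarith)
          ((continuous_riemannZeta_vertical (by linarith)).norm.intervalIntegrable _ _)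
          (Continuous.intervalIntegrable (by fun_prop) _ _)
          fun t ht ↦ norm_zeta_le_two_div_add hε hε1 (abs_le.mpr ht)
    _ = 4 * Real.log ((ε + δ) / ε) + 2 * δ * (5 + 2 * δ) := by
      rw [intervalIntegral.integral_add ((hc.const_mul 2).intervalIntegrable _ _)
        intervalIntegrable_const, intervalIntegral.integral_const_mul, integral_inv_add_abs hε hδ,
        intervalIntegral.integral_const, smul_eq_mul]
      ring

theorem continuousOn_inv_norm_zeta_one_line :
    ContinuousOn (fun t : ℝ ↦ ‖riemannZeta ((1 : ℝ) + t * I)‖⁻¹) (Set.Ioi 0) := by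
  intro t ht
  have hne : ((1 : ℝ) + t * I : ℂ) ≠ 1 := fun h ↦ by
    have := congrArg Complex.im h
    simp at this
    exact (Set.mem_Ioi.mp ht).ne' this
  refine ContinuousAt.continuousWithinAt (ContinuousAt.inv₀ (ContinuousAt.norm
    (ContinuousAt.comp (g := riemannZeta) (f := fun t : ℝ ↦ ((1 : ℝ) + t * I : ℂ))
      (differentiableAt_riemannZeta hne).continuousAt (by fun_prop))) ?_)
  exact norm_ne_zero_iff.mpr (riemannZeta_ne_zero_of_one_le_re (by simp))

theorem integral_inv_zeta_one_line_le {δ T : ℝ} (hδ : 0 < δ) (hT : 3 ≤ T) (hTδ : δ ≤ T)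
    (hK : 6048 * 124 ^ 4 ≤ Real.log T) (hpow : Real.log T ^ 10 ≤ T) :
    ∫ t in T..(T + δ), ‖riemannZeta ((1 : ℝ) + t * I)‖⁻¹ ≤
      160 * Real.log (Real.log T) + (16 * Real.log (1 + δ) + 8 * δ * (5 + 2 * δ)) := by
  set l := Real.log T with hl
  have hl1 : 1 ≤ l := one_le_log_of_three_le hT
  have hl0 : 0 < l := by linarith
  set ε := (l ^ 10)⁻¹ with hεdef
  have hε : 0 < ε := by positivity
  have hε1 : ε ≤ 1 := inv_le_one_of_one_le₀ (one_le_pow₀ hl1)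
  have hKε : 6048 * 124 ^ 4 * (ε * l ^ 9) ≤ 1 := by
    have : ε * l ^ 9 = l⁻¹ := by rw [hεdef]; field_simp
    rw [this, ← div_eq_mul_inv]
    exact (div_le_one hl0).mpr hK
  have hpt (t : ℝ) (ht : t ∈ Set.Icc T (T + δ)) :
      ‖riemannZeta ((1 : ℝ) + t * I)‖⁻¹ ≤ 2 * ‖riemannZeta ((1 + ε : ℝ) + t * I)‖⁻¹ := by
    have ht0 : 0 < t := by linarith [ht.1]
    refine inv_norm_zeta_le_two_mul hε hε1 hl1 (by linarith [ht.1]) ?_ ?_ hKε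
    · calc Real.log t ≤ Real.log (T ^ 2) := Real.log_le_log ht0 (by nlinarith [ht.2])
        _ = 2 * l := by rw [Real.log_pow, ← hl]; norm_num
    · rw [one_div]
      exact inv_anti₀ (by positivity) (hpow.trans ht.1)
  have hint : IntervalIntegrable (fun t : ℝ ↦ ‖riemannZeta ((1 : ℝ) + t * I)‖⁻¹) volume T (T + δ) :=
    (continuousOn_inv_norm_zeta_one_line.mono fun t ht ↦ by
      rw [Set.uIcc_of_le (by linarith)] at ht
      exact Set.mem_Ioi.mpr (by linarith [ht.1])).intervalIntegrable
  have h1 := intervalIntegral.integral_mono_on (by linarith) hint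
    (((continuous_inv_norm_riemannZeta_vertical (σ := 1 + ε) (by linarith)).const_mul
      2).intervalIntegrable _ _) hpt
  rw [intervalIntegral.integral_const_mul] at h1
  have h2 := integral_inv_zeta_le (σ := 1 + ε) hδ (by linarith) T
  have h3 := integral_norm_zeta_near_one_le hε hε1 hδ
  have h4 : Real.log ((ε + δ) / ε) ≤ Real.log (1 + δ) + 10 * Real.log l := by
    calc Real.log ((ε + δ) / ε) ≤ Real.log ((1 + δ) * l ^ 10) := by
          rw [div_eq_mul_inv, hεdef, inv_inv]
          gcongr
      _ = Real.log (1 + δ) + 10 * Real.log l := by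
          rw [Real.log_mul (by positivity) (by positivity), Real.log_pow]
          norm_num
  linarith

theorem stmt_11  (δ : ℝ) (hδ : 0 < δ) :
    ∃ C > (0 : ℝ), ∃ T₀ : ℝ, (3 : ℝ) ≤ T₀ ∧ ∀ T : ℝ, T₀ ≤ T →
      (∫ t in T..(T + δ), ‖riemannZeta (1 + t * Complex.I)‖ ^ ((-1 : ℝ))) ≤ C * Real.log (Real.log T) := by
  have hC : 0 ≤ 16 * Real.log (1 + δ) + 8 * δ * (5 + 2 * δ) := by
    have := Real.log_nonneg (show 1 ≤ 1 + δ by linarith)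
    positivity
  have hev : ∀ᶠ T : ℝ in atTop, 3 ≤ T ∧ δ ≤ T ∧ 6048 * 124 ^ 4 ≤ Real.log T ∧
      Real.log T ^ 10 ≤ T ∧ 1 ≤ Real.log (Real.log T) := by
    have hpow : ∀ᶠ T : ℝ in atTop, Real.log T ^ 10 ≤ T := by
      filter_upwards [(Real.isLittleO_pow_log_id_atTop (n := 10)).bound one_pos,
        eventually_ge_atTop 0] with T hT hT0
      rw [one_mul, id, Real.norm_of_nonneg hT0] at hT
      exact (Real.le_norm_self _).trans hT
    filter_upwards [eventually_ge_atTop 3, eventually_ge_atTop δ,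
      Real.tendsto_log_atTop.eventually_ge_atTop (6048 * 124 ^ 4), hpow,
      (Real.tendsto_log_atTop.comp Real.tendsto_log_atTop).eventually_ge_atTop 1]
      with T h1 h2 h3 h4 h5
    exact ⟨h1, h2, h3, h4, h5⟩
  obtain ⟨T₀, hT₀⟩ := eventually_atTop.mp hev
  refine ⟨160 + (16 * Real.log (1 + δ) + 8 * δ * (5 + 2 * δ)), by linarith, T₀,
    (hT₀ T₀ le_rfl).1, fun T hT ↦ ?_⟩
  obtain ⟨h1, h2, h3, h4, h5⟩ := hT₀ T hT
  have h := integral_inv_zeta_one_line_le hδ h1 h2 h3 h4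
  simp only [ofReal_one] at h
  simp only [Real.rpow_neg_one]
  refine h.trans ?_
  rw [add_mul]
  gcongr
  exact le_mul_of_one_le_right hC h5
end

section
/- Assume the Riemann hypothesis. Then for every δ > 0 and every real p > 1 there exist constants C > 0 and T₀ ≥ 16 such that for all T ≥ T₀, ∫_T^{T+δ} |ζ(1+it)|^p dt ≤ C · (log log log T) · (log log T)^{p−1}. -/
open Complex Real Filter MeasureTheory intervalIntegral

theorem hasDerivAt_ofReal_cpow_pos {y : ℝ} (hy : 0 < y) (r : ℂ) :
    HasDerivAt (fun u : ℝ ↦ (u : ℂ) ^ r) (r * (y : ℂ) ^ (r - 1)) y := by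
  have h := (hasDerivAt_id (y : ℂ)).cpow_const (c := r) (by simp [hy])
  simpa using h.comp_ofReal

theorem norm_cpow_neg_sub_le {x y : ℝ} (hx : 1 ≤ x) (hy : y ∈ Set.Icc x (x + 1)) {s : ℂ}
    (hs : 0 < s.re) :
    ‖(y : ℂ) ^ (-s) - (x : ℂ) ^ (-s)‖ ≤ ‖s‖ * x ^ (-s.re - 1) := by
  have h := Convex.norm_image_sub_le_of_norm_hasDerivWithin_le (𝕜 := ℝ)
    (f := fun u : ℝ ↦ (u : ℂ) ^ (-s)) (f' := fun u : ℝ ↦ -s * (u : ℂ) ^ (-s - 1))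
    (s := Set.Icc x (x + 1)) (C := ‖s‖ * x ^ (-s.re - 1)) (x := x) (y := y)
    (fun u hu ↦ (hasDerivAt_ofReal_cpow_pos (by linarith [hu.1]) (-s)).hasDerivWithinAt)
    (fun u hu ↦ by
      have hu0 : 0 < u := by linarith [hu.1]
      rw [norm_mul, norm_neg, norm_cpow_eq_rpow_re_of_pos hu0]
      have : u ^ (-s - 1).re ≤ x ^ (-s.re - 1) := by
        simp only [sub_re, neg_re, one_re]
        exact Real.rpow_le_rpow_of_nonpos (by linarith) hu.1 (by linarith)
      gcongr)
    (convex_Icc _ _) ⟨le_refl x, by linarith⟩ hy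
  refine h.trans ?_
  have h1 : ‖y - x‖ ≤ 1 := by
    rw [Real.norm_eq_abs, abs_of_nonneg (by linarith [hy.1])]; linarith [hy.2]
  have h2 : 0 ≤ ‖s‖ * x ^ (-s.re - 1) := by positivity
  nlinarith

theorem norm_cpow_one_sub_taylor_le {x : ℝ} (hx : 1 ≤ x) {s : ℂ} (hs : 0 < s.re) :
    ‖((x + 1 : ℝ) : ℂ) ^ (1 - s) - (x : ℂ) ^ (1 - s) - (1 - s) * (x : ℂ) ^ (-s)‖ ≤
      ‖s - 1‖ * ‖s‖ * x ^ (-s.re - 1) := by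
  have h := Convex.norm_image_sub_le_of_norm_hasDerivWithin_le (𝕜 := ℝ)
    (f := fun u : ℝ ↦ (u : ℂ) ^ (1 - s) - u * ((1 - s) * (x : ℂ) ^ (-s)))
    (f' := fun u : ℝ ↦ (1 - s) * ((u : ℂ) ^ (-s) - (x : ℂ) ^ (-s)))
    (s := Set.Icc x (x + 1)) (C := ‖s - 1‖ * ‖s‖ * x ^ (-s.re - 1)) (x := x) (y := x + 1)
    (fun u hu ↦ by
      have h1 := hasDerivAt_ofReal_cpow_pos (show 0 < u by linarith [hu.1]) (1 - s)
      have h2 := ((hasDerivAt_id u).ofReal_comp.mul_const ((1 - s) * (x : ℂ) ^ (-s)))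
      rw [show (1 - s - 1) = -s by ring] at h1
      refine ((h1.sub h2).hasDerivWithinAt).congr_deriv ?_
      push_cast
      ring)
    (fun u hu ↦ by
      rw [norm_mul, norm_sub_rev, mul_assoc]
      gcongr
      exact norm_cpow_neg_sub_le hx hu hs)
    (convex_Icc _ _) ⟨le_refl x, by linarith⟩ ⟨by linarith, le_refl _⟩
  simp only [add_sub_cancel_left, norm_one, mul_one] at h
  refine le_of_eq_of_le (congrArg norm ?_) h
  push_cast
  ring

/-- The summands of the expansion `(s - 1) ζ(s) = 1 + ∑ n, zetaTerm n s`, valid for `0 < Re s`. -/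
noncomputable def zetaTerm (n : ℕ) (s : ℂ) : ℂ :=
  ((n + 2 : ℝ) : ℂ) ^ (1 - s) - ((n + 1 : ℝ) : ℂ) ^ (1 - s) - (1 - s) * ((n + 1 : ℝ) : ℂ) ^ (-s)

theorem norm_zetaTerm_le (n : ℕ) {s : ℂ} (hs : 1 / 2 < s.re) :
    ‖zetaTerm n s‖ ≤ ‖s - 1‖ * ‖s‖ * (1 / ((n : ℝ) + 1) ^ (3 / 2 : ℝ)) := by
  have h := norm_cpow_one_sub_taylor_le (x := (n : ℝ) + 1) (by simp) (s := s) (by linarith)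
  rw [show (n : ℝ) + 1 + 1 = n + 2 by ring] at h
  refine h.trans ?_
  rw [one_div, ← Real.rpow_neg (by positivity)]
  gcongr
  · simp
  · linarith

theorem summable_zetaTerm_bound : Summable fun n : ℕ ↦ 1 / ((n : ℝ) + 1) ^ (3 / 2 : ℝ) := by
  exact_mod_cast (summable_nat_add_iff 1).mpr
    (Real.summable_one_div_nat_rpow.mpr (show (1 : ℝ) < 3 / 2 by norm_num))

theorem differentiable_zetaTerm (n : ℕ) : Differentiable ℂ (zetaTerm n) := by
  intro s
  unfold zetaTerm
  have h1 : ((n + 2 : ℝ) : ℂ) ≠ 0 := by exact_mod_cast (by positivity : ((n : ℝ) + 2) ≠ 0)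
  have h2 : ((n + 1 : ℝ) : ℂ) ≠ 0 := by exact_mod_cast (by positivity : ((n : ℝ) + 1) ≠ 0)
  have h3 : DifferentiableAt ℂ (fun s : ℂ ↦ 1 - s) s := by fun_prop
  have h4 : DifferentiableAt ℂ (fun s : ℂ ↦ - s) s := by fun_prop
  exact ((h3.const_cpow (.inl h1)).sub (h3.const_cpow (.inl h2))).sub
    (h3.mul (h4.const_cpow (.inl h2)))

theorem one_add_tsum_zetaTerm_of_one_lt_re {s : ℂ} (hs : 1 < s.re) :
    1 + ∑' n, zetaTerm n s = riemannZeta₁ s := by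
  have hs1 : s ≠ 1 := by rintro rfl; simp at hs
  have hz : HasSum (fun n : ℕ ↦ 1 / ((n : ℂ) + 1) ^ s) (riemannZeta s) := by
    rw [zeta_eq_tsum_one_div_nat_add_one_cpow hs]
    apply Summable.hasSum
    have := (summable_nat_add_iff 1).mpr (Complex.summable_one_div_nat_cpow.mpr hs)
    exact_mod_cast this
  have htel : Tendsto (fun N : ℕ ↦ ((N + 1 : ℝ) : ℂ) ^ (1 - s)) atTop (nhds 0) := by
    rw [tendsto_zero_iff_norm_tendsto_zero]
    have h1 : Tendsto (fun N : ℕ ↦ ((N : ℝ) + 1) ^ (-(s.re - 1))) atTop (nhds 0) :=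
      (tendsto_rpow_neg_atTop (by linarith)).comp
        (tendsto_atTop_add_const_right _ _ tendsto_natCast_atTop_atTop)
    refine h1.congr fun N ↦ ?_
    rw [norm_cpow_eq_rpow_re_of_pos (by positivity)]
    simp
  have hsum : Summable fun n ↦ zetaTerm n s :=
    Summable.of_norm_bounded (summable_zetaTerm_bound.mul_left (‖s - 1‖ * ‖s‖))
      fun n ↦ norm_zetaTerm_le n (by linarith)
  have hlim : Tendsto (fun N : ℕ ↦ ∑ n ∈ Finset.range N, zetaTerm n s) atTop
      (nhds (0 - 1 + (s - 1) * riemannZeta s)) := by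
    refine ((htel.sub_const 1).add (hz.tendsto_sum_nat.const_mul (s - 1))).congr fun N ↦ ?_
    induction N with
    | zero => simp
    | succ N ih =>
      rw [Finset.sum_range_succ, Finset.sum_range_succ, ← ih, zetaTerm, mul_add, cpow_neg]
      push_cast
      rw [show (N : ℂ) + 1 + 1 = N + 2 by ring]
      ring
  rw [tendsto_nhds_unique hsum.hasSum.tendsto_sum_nat hlim, riemannZeta_eq_inv_sub_mul hs1]
  field_simp [sub_ne_zero.mpr hs1]
  ring

theorem one_add_tsum_zetaTerm {s : ℂ} (hs : 1 / 2 < s.re) :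
    1 + ∑' n, zetaTerm n s = riemannZeta₁ s := by
  set R : ℝ := ‖s‖ + 3
  set U : Set ℂ := {z | 1 / 2 < z.re} ∩ Metric.ball 0 R with hU
  have hUo : IsOpen U := (isOpen_lt continuous_const continuous_re).inter Metric.isOpen_ball
  have hUc : Convex ℝ U := (convex_halfSpace_re_gt _).inter (convex_ball _ _)
  have hd : DifferentiableOn ℂ (fun z ↦ 1 + ∑' n, zetaTerm n z) U := by
    refine (differentiableOn_const 1).add ?_
    refine differentiableOn_tsum_of_summable_norm
      (summable_zetaTerm_bound.mul_left ((R + 1) * R))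
      (fun n ↦ (differentiable_zetaTerm n).differentiableOn) hUo fun n z hz ↦ ?_
    refine (norm_zetaTerm_le n hz.1).trans ?_
    have h1 : ‖z‖ ≤ R := (mem_ball_zero_iff.mp hz.2).le
    have h2 : ‖z - 1‖ ≤ R + 1 := (norm_sub_le _ _).trans (by simpa using h1)
    gcongr
  have h2 : (2 : ℂ) ∈ U := ⟨by norm_num, by
    rw [mem_ball_zero_iff]; simp only [Complex.norm_ofNat, R]; linarith [norm_nonneg s]⟩
  refine AnalyticOnNhd.eqOn_of_preconnected_of_eventuallyEq (hd.analyticOnNhd hUo)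
    (differentiable_riemannZeta₁.differentiableOn.analyticOnNhd hUo)
    hUc.isPreconnected h2 ?_ ⟨hs, by rw [mem_ball_zero_iff]; simp [R]⟩
  filter_upwards [(isOpen_lt continuous_const continuous_re).mem_nhds
    (show (1 : ℝ) < (2 : ℂ).re by norm_num)] with z hz
  exact one_add_tsum_zetaTerm_of_one_lt_re hz

theorem exists_norm_riemannZeta_le :
    ∃ C > 0, ∀ s : ℂ, 1 / 2 < s.re → s ≠ 1 → ‖riemannZeta s‖ ≤ ‖s - 1‖⁻¹ + C * ‖s‖ := by
  set C : ℝ := ∑' n : ℕ, 1 / ((n : ℝ) + 1) ^ (3 / 2 : ℝ)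
  refine ⟨C, summable_zetaTerm_bound.tsum_pos (fun n ↦ by positivity) 0 (by positivity),
    fun s hs hs1 ↦ ?_⟩
  have hpos : 0 < ‖s - 1‖ := norm_pos_iff.mpr (sub_ne_zero.mpr hs1)
  have h : ‖∑' n, zetaTerm n s‖ ≤ ‖s - 1‖ * ‖s‖ * C := by
    refine tsum_of_norm_bounded (summable_zetaTerm_bound.hasSum.mul_left _) fun n ↦
      norm_zetaTerm_le n hs
  rw [riemannZeta_eq_inv_sub_mul hs1, ← one_add_tsum_zetaTerm hs, norm_mul, norm_inv]
  have h' : ‖1 + ∑' n, zetaTerm n s‖ ≤ 1 + ‖s - 1‖ * ‖s‖ * C :=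
    (norm_add_le _ _).trans (by rw [norm_one]; gcongr)
  calc ‖s - 1‖⁻¹ * _ ≤ ‖s - 1‖⁻¹ * (1 + ‖s - 1‖ * ‖s‖ * C) := by gcongr
    _ = _ := by field_simp

theorem norm_deriv_div_self_le_of_forall_mem_ball {f : ℂ → ℂ} {c s : ℂ} {B : ℝ}
    (hf : DifferentiableOn ℂ f (Metric.ball c (11 / 8))) (h0 : ∀ z ∈ Metric.ball c (11 / 8), f z ≠ 0)
    (hB : 1 < B) (hfB : ∀ z ∈ Metric.ball c (11 / 8), ‖f z‖ ≤ B * ‖f c‖) (hs : ‖s - c‖ ≤ 5 / 4) :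
    ‖deriv f s / f s‖ ≤ 672 * Real.log B := by
  have hopen : IsOpen (Metric.ball c (11 / 8 : ℝ)) := Metric.isOpen_ball
  have hc : c ∈ Metric.ball c (11 / 8 : ℝ) := Metric.mem_ball_self (by norm_num)
  obtain ⟨L, hL0, hL⟩ := (((hf.deriv hopen).div hf h0).isExactOn_ball).with_val_at c 0
  have hexp : ∀ z ∈ Metric.ball c (11 / 8 : ℝ), f z = f c * Complex.exp (L z) := by
    intro z hz
    have hconst : ∀ w ∈ Metric.ball c (11 / 8 : ℝ),
        HasDerivAt (fun w ↦ f w * Complex.exp (-L w)) 0 w := by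
      intro w hw
      have h1 := (hf.differentiableAt (hopen.mem_nhds hw)).hasDerivAt
      refine (h1.mul (hL w hw).neg.cexp).congr_deriv ?_
      simp only [Pi.div_apply]
      field_simp [h0 w hw]
      ring
    have := (convex_ball c (11 / 8 : ℝ)).is_const_of_fderivWithin_eq_zero (𝕜 := ℂ)
      (f := fun w ↦ f w * Complex.exp (-L w))
      (fun w hw ↦ (hconst w hw).differentiableAt.differentiableWithinAt)
      (fun w hw ↦ by
        rw [fderivWithin_of_isOpen hopen hw]
        have := (hconst w hw).hasFDerivAt.fderiv
        rw [this]; ext; simp) hz hc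
    simp only [hL0, neg_zero, Complex.exp_zero, mul_one, Complex.exp_neg] at this
    rw [← this]
    field_simp [Complex.exp_ne_zero]
  have hM : 0 < Real.log B := Real.log_pos hB
  have hre : ∀ z ∈ Metric.ball c (11 / 8 : ℝ), (L z).re ≤ Real.log B := by
    intro z hz
    have h1 := hfB z hz
    rw [hexp z hz, norm_mul, Complex.norm_exp, mul_comm] at h1
    have h2 : Real.exp (L z).re ≤ B := le_of_mul_le_mul_right h1 (norm_pos_iff.mpr (h0 c hc))
    exact (Real.le_log_iff_exp_le (by linarith)).mpr h2
  have hLbound : ∀ z, ‖z - c‖ ≤ 21 / 16 → ‖L z‖ ≤ 42 * Real.log B := by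
    intro z hz
    have h := borelCaratheodory_zero (f := fun w ↦ L (c + w)) (R := 11 / 8) (z := z - c) hM
      (fun w hw ↦ by
        have hw' : c + w ∈ Metric.ball c (11 / 8 : ℝ) := by simpa using hw
        have := (hL _ hw').differentiableAt
        exact (this.comp w (by fun_prop)).differentiableWithinAt)
      (fun w hw ↦ hre _ (by simpa using hw)) (by norm_num)
      (by rw [mem_ball_zero_iff]; linarith) (by simpa using hL0)
    simp only [add_sub_cancel] at h
    refine h.trans ?_
    rw [div_le_iff₀ (by linarith)]
    nlinarith
  have hsb : ∀ z, ‖z - s‖ ≤ 1 / 16 → ‖z - c‖ ≤ 21 / 16 := fun z hz ↦ by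
    calc ‖z - c‖ = ‖(z - s) + (s - c)‖ := by ring_nf
      _ ≤ _ := (norm_add_le _ _).trans (by linarith)
  have hmem : ∀ z, ‖z - s‖ ≤ 1 / 16 → z ∈ Metric.ball c (11 / 8 : ℝ) := fun z hz ↦ by
    rw [mem_ball_iff_norm]; linarith [hsb z hz]
  have hder : deriv L s = deriv f s / f s := (hL s (hmem s (by simp))).deriv
  rw [← hder]
  refine (norm_deriv_le_of_forall_mem_sphere_norm_le (R := 1 / 16) (C := 42 * Real.log B)
    (by norm_num) ?_ fun z hz ↦ hLbound z (hsb z (mem_sphere_iff_norm.mp hz).le)).trans ?_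
  · refine DifferentiableOn.diffContOnCl fun z hz ↦ ?_
    have hz' := Metric.closure_ball_subset_closedBall hz
    exact (hL z (hmem z (mem_closedBall_iff_norm.mp hz'))).differentiableAt.differentiableWithinAt
  · linarith

theorem one_fourth_le_norm_riemannZeta {s : ℂ} (hs : s.re = 2) : 1 / 4 ≤ ‖riemannZeta s‖ := by
  have h1 : HasSum (fun n : ℕ ↦ 1 / ((n : ℂ) + 1) ^ s) (riemannZeta s) := by
    rw [zeta_eq_tsum_one_div_nat_add_one_cpow (by linarith)]
    apply Summable.hasSum
    have := (summable_nat_add_iff 1).mpr (Complex.summable_one_div_nat_cpow.mpr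
      (show 1 < s.re by linarith))
    exact_mod_cast this
  have h2 : HasSum (fun n : ℕ ↦ 1 / ((n : ℝ) + 2) ^ 2) (π ^ 2 / 6 - 1) := by
    have := (hasSum_nat_add_iff' 2).mpr hasSum_zeta_two
    simpa [Finset.sum_range_succ] using this
  have h3 := (hasSum_nat_add_iff' 1).mpr h1
  have h4 : ‖riemannZeta s - 1‖ ≤ π ^ 2 / 6 - 1 := by
    have h5 := tsum_of_norm_bounded h2 (f := fun n : ℕ ↦ 1 / (((n + 1 : ℕ) : ℂ) + 1) ^ s)
      fun n ↦ by
        rw [norm_div, norm_one, show (((n + 1 : ℕ) : ℂ) + 1) = ((n + 2 : ℝ) : ℂ) by push_cast; ring,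
          norm_cpow_eq_rpow_re_of_pos (by positivity), hs]
        norm_num
    rw [h3.tsum_eq] at h5
    simpa using h5
  have h5 : 1 - ‖riemannZeta s‖ ≤ ‖riemannZeta s - 1‖ := by
    rw [norm_sub_rev]
    simpa using norm_sub_norm_le (1 : ℂ) (riemannZeta s)
  nlinarith [Real.pi_lt_d2, Real.pi_pos]

theorem riemannZeta_ne_zero_of_half_lt_re (hRH : RiemannHypothesis) {s : ℂ} (hs : 1 / 2 < s.re)
    (hs1 : s ≠ 1) : riemannZeta s ≠ 0 := fun h ↦ by
  refine hs.ne' (hRH s h ?_ hs1)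
  rintro ⟨n, rfl⟩
  have : ((-2 * ((n : ℂ) + 1)).re) = -2 * ((n : ℝ) + 1) := by simp
  rw [this] at hs
  have : (0 : ℝ) ≤ n := by positivity
  linarith

theorem exists_norm_logDeriv_riemannZeta_le_log (hRH : RiemannHypothesis) :
    ∃ K > 0, ∀ s : ℂ, 3 / 4 ≤ s.re → s.re ≤ 2 → 4 ≤ s.im →
      ‖deriv riemannZeta s / riemannZeta s‖ ≤ K * Real.log s.im := by
  obtain ⟨C, hC, hζ⟩ := exists_norm_riemannZeta_le
  have hA : 0 < Real.log (4 * (1 + 2 * C)) := Real.log_pos (by linarith)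
  refine ⟨672 * (Real.log (4 * (1 + 2 * C)) + 1), by positivity, fun s h1 h2 h3 ↦ ?_⟩
  set t := s.im with ht
  set c : ℂ := ⟨2, t⟩ with hc
  have hball : ∀ z ∈ Metric.ball c (11 / 8 : ℝ), 1 / 2 < z.re ∧ 1 ≤ z.im ∧ ‖z‖ ≤ 2 * t := by
    intro z hz
    rw [mem_ball_iff_norm] at hz
    have hr := (abs_lt.mp ((abs_re_le_norm _).trans_lt hz)).1
    have hi := (abs_lt.mp ((abs_im_le_norm _).trans_lt hz)).1
    simp only [sub_re, sub_im, hc] at hr hi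
    refine ⟨by linarith, by linarith, ?_⟩
    have hcn : ‖c‖ ≤ 2 + t := by
      refine (norm_le_abs_re_add_abs_im c).trans ?_
      simp [hc, abs_of_pos (show 0 < t by linarith)]
    have := norm_add_le (z - c) c
    rw [sub_add_cancel] at this
    linarith
  have hne1 : ∀ z ∈ Metric.ball c (11 / 8 : ℝ), z ≠ 1 := by
    rintro z hz rfl
    have := (hball 1 hz).2.1
    norm_num at this
  have hlog : 1 ≤ Real.log t := by
    rw [Real.le_log_iff_exp_le (by linarith)]
    linarith [Real.exp_one_lt_d9]
  have key := norm_deriv_div_self_le_of_forall_mem_ball (f := riemannZeta) (c := c) (s := s)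
    (B := 4 * (1 + 2 * C) * t)
    (fun z hz ↦ (differentiableAt_riemannZeta (hne1 z hz)).differentiableWithinAt)
    (fun z hz ↦ riemannZeta_ne_zero_of_half_lt_re hRH (hball z hz).1 (hne1 z hz))
    (by nlinarith)
    (fun z hz ↦ by
      obtain ⟨hz1, hz2, hz3⟩ := hball z hz
      have hc4 := one_fourth_le_norm_riemannZeta (s := c) rfl
      have hinv : ‖z - 1‖⁻¹ ≤ 1 := by
        refine inv_le_one_of_one_le₀ (hz2.trans ?_)
        have := abs_im_le_norm (z - 1)
        simp only [sub_im, one_im, sub_zero] at this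
        exact (le_abs_self _).trans this
      have h5 := hζ z hz1 (hne1 z hz)
      have h6 : C * ‖z‖ ≤ C * (2 * t) := by gcongr
      have h7 : 0 ≤ 4 * (1 + 2 * C) * t := by nlinarith
      nlinarith)
    (by
      have : s - c = ((s.re - 2 : ℝ) : ℂ) := by
        apply Complex.ext <;> simp [hc, ht]
      rw [this, Complex.norm_real, Real.norm_eq_abs, abs_le]
      constructor <;> linarith)
  refine key.trans ?_
  rw [Real.log_mul (by positivity) (by positivity)]
  nlinarith

theorem exists_norm_logDeriv_riemannZeta_le_inv :
    ∃ K > 0, ∀ s : ℂ, 1 < s.re → s.re ≤ 2 →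
      ‖deriv riemannZeta s / riemannZeta s‖ ≤ K / (s.re - 1) := by
  have hne : ∀ σ ∈ Set.Icc (1 : ℝ) 2, riemannZeta₁ σ ≠ 0 := by
    intro σ hσ
    rcases eq_or_ne σ 1 with rfl | h
    · simp
    · have h1 : (σ : ℂ) ≠ 1 := by exact_mod_cast h
      have h2 := riemannZeta_ne_zero_of_one_le_re (s := σ) (by simpa using hσ.1)
      rw [riemannZeta_eq_inv_sub_mul h1] at h2
      exact right_ne_zero_of_mul h2
  have hcont : ContinuousOn (fun σ : ℝ ↦ ((σ : ℂ) - 1) * (deriv riemannZeta₁ σ / riemannZeta₁ σ) - 1)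
      (Set.Icc 1 2) := by
    have h1 : Continuous (deriv riemannZeta₁) :=
      (differentiable_riemannZeta₁.contDiff (n := 1)).continuous_deriv le_rfl
    have h2 := differentiable_riemannZeta₁.continuous
    refine ((by fun_prop : ContinuousOn (fun σ : ℝ ↦ (σ : ℂ) - 1) (Set.Icc 1 2)).mul
      (ContinuousOn.div ?_ ?_ hne)).sub continuousOn_const
    · exact (h1.comp continuous_ofReal).continuousOn
    · exact (h2.comp continuous_ofReal).continuousOn
  obtain ⟨K, hK⟩ := isCompact_Icc.exists_bound_of_continuousOn hcont
  refine ⟨|K| + 1, by positivity, fun s h1 h2 ↦ ?_⟩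
  set σ := s.re with hσ
  have hσ1 : 1 < (σ : ℂ).re := by simpa using h1
  have hs1 : (σ : ℂ) ≠ 1 := by exact_mod_cast h1.ne'
  have hreal : ‖deriv riemannZeta σ / riemannZeta σ‖ ≤ (|K| + 1) / (σ - 1) := by
    have h4 := hK σ ⟨h1.le, h2⟩
    have h5 : deriv riemannZeta σ / riemannZeta σ =
        (((σ : ℂ) - 1) * (deriv riemannZeta₁ σ / riemannZeta₁ σ) - 1) * ((σ - 1 : ℝ) : ℂ)⁻¹ := by
      rw [deriv_riemannZeta_eq_neg_inv_sub_sq_mul_add hs1, riemannZeta_eq_inv_sub_mul hs1]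
      have h6 := hne σ ⟨h1.le, h2⟩
      have h7 := sub_ne_zero.mpr hs1
      push_cast
      field_simp
      ring
    rw [h5, norm_mul, norm_inv, Complex.norm_real, Real.norm_eq_abs,
      abs_of_pos (by linarith : 0 < σ - 1), div_eq_mul_inv (|K| + 1)]
    exact mul_le_mul_of_nonneg_right (h4.trans (by linarith [le_abs_self K]))
      (inv_nonneg.mpr (by linarith))
  refine le_trans ?_ hreal
  have hL := ArithmeticFunction.LSeries_vonMangoldt_eq_deriv_riemannZeta_div h1
  have hL' := ArithmeticFunction.LSeries_vonMangoldt_eq_deriv_riemannZeta_div hσ1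
  rw [← norm_neg, ← neg_div, ← hL, ← norm_neg (_ / _), ← neg_div, ← hL']
  have hnorm : ∀ n, ‖LSeries.term (fun n ↦ (ArithmeticFunction.vonMangoldt n : ℂ)) s n‖ =
      ‖LSeries.term (fun n ↦ (ArithmeticFunction.vonMangoldt n : ℂ)) σ n‖ := fun n ↦ by
    rw [LSeries.norm_term_eq, LSeries.norm_term_eq, ofReal_re]
  have hofReal : ∀ n, LSeries.term (fun n ↦ (ArithmeticFunction.vonMangoldt n : ℂ)) σ n =
      ((‖LSeries.term (fun n ↦ (ArithmeticFunction.vonMangoldt n : ℂ)) σ n‖ : ℝ) : ℂ) := fun n ↦ by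
    rw [LSeries.norm_term_eq, LSeries.term_def]
    split_ifs with hn
    · simp
    · rw [Complex.norm_real, Real.norm_of_nonneg ArithmeticFunction.vonMangoldt_nonneg,
        ofReal_re, ofReal_div, ofReal_cpow (by positivity)]
      simp
  have hsum := (ArithmeticFunction.LSeriesSummable_vonMangoldt hσ1).norm
  unfold LSeries
  rw [tsum_congr hofReal, ← ofReal_tsum, Complex.norm_real,
    Real.norm_of_nonneg (tsum_nonneg fun n ↦ norm_nonneg _)]
  exact tsum_of_norm_bounded hsum.hasSum fun n ↦ (hnorm n).le

theorem norm_logDeriv_riemannZeta_le_of_strip_bounds {K₁ K₂ : ℝ} (hK₁ : 0 < K₁) (hK₂ : 0 < K₂)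
    (h₁ : ∀ s : ℂ, 3 / 4 ≤ s.re → s.re ≤ 2 → 4 ≤ s.im →
      ‖deriv riemannZeta s / riemannZeta s‖ ≤ K₁ * Real.log s.im)
    (h₂ : ∀ s : ℂ, 1 < s.re → s.re ≤ 2 →
      ‖deriv riemannZeta s / riemannZeta s‖ ≤ K₂ / (s.re - 1))
    (hne : ∀ s : ℂ, 1 / 2 < s.re → s ≠ 1 → riemannZeta s ≠ 0)
    {L : ℝ} (hL : 2 ≤ L) {s : ℂ} (hs1 : 1 ≤ s.re) (hs2 : s.re ≤ 1 + 1 / L)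
    (hsL : Real.log (Real.log s.im) = L) (him : L + 4 ≤ s.im) (hlog : 1 ≤ Real.log s.im) :
    ‖deriv riemannZeta s / riemannZeta s‖ ≤ (2 * K₁ + K₂) * Real.exp 5 * L := by
  have hL0 : 0 < L := by linarith
  have hη1 : 1 / L ≤ 1 / 2 := one_div_le_one_div_of_le (by norm_num) hL
  have hη0 : 0 < 1 / L := by positivity
  have hLη : L * (1 / L) = 1 := by field_simp
  have hlogL : Real.log s.im = Real.exp L := by rw [← hsL, Real.exp_log (by linarith)]
  set U : Set ℂ := Set.Ioo (3 / 4) (1 + 1 / L) ×ℂ Set.Ioo (s.im - L) (s.im + L) with hU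
  have hclos : closure U = Set.Icc (3 / 4) (1 + 1 / L) ×ℂ Set.Icc (s.im - L) (s.im + L) := by
    rw [hU, closure_reProdIm, closure_Ioo (by linarith), closure_Ioo (by linarith)]
  set g : ℂ → ℂ := fun z ↦ deriv riemannZeta z / riemannZeta z *
    Complex.exp ((z - s) ^ 2 + 4 * L * (z - s)) with hg
  have hnormg : ∀ z, ‖g z‖ = ‖deriv riemannZeta z / riemannZeta z‖ *
      Real.exp ((z.re - s.re) ^ 2 - (z.im - s.im) ^ 2 + 4 * L * (z.re - s.re)) := by
    intro z
    rw [hg, norm_mul, Complex.norm_exp]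
    congr 2
    simp [pow_two]
  have hd : DiffContOnCl ℂ g U := by
    refine DifferentiableOn.diffContOnCl fun z hz ↦ ?_
    rw [hclos, mem_reProdIm] at hz
    have hz1 : z ≠ 1 := by
      rintro rfl
      have := hz.2.1
      simp only [one_im] at this
      linarith
    have hzd : DifferentiableAt ℂ (deriv riemannZeta) z :=
      ((differentiableOn_riemannZeta.deriv isOpen_compl_singleton).differentiableAt
        (isOpen_compl_singleton.mem_nhds hz1))
    exact ((hzd.div (differentiableAt_riemannZeta hz1)
      (hne z (by linarith [hz.1.1]) hz1)).mul (by fun_prop)).differentiableWithinAt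
  have hbdd : Bornology.IsBounded U :=
    (Metric.isBounded_Ioo _ _).reProdIm (Metric.isBounded_Ioo _ _)
  have hlog2 : ∀ z : ℂ, z.im ∈ Set.Icc (s.im - L) (s.im + L) →
      Real.log z.im ≤ 2 * Real.exp L := by
    intro z hz
    have h3 : Real.log z.im ≤ Real.log (2 * s.im) :=
      Real.log_le_log (by linarith [hz.1]) (by linarith [hz.2])
    rw [Real.log_mul (by norm_num) (by linarith), hlogL] at h3
    have := Real.log_two_lt_d9
    rw [hlogL] at hlog
    linarith
  have hfr : ∀ z ∈ frontier U, ‖g z‖ ≤ (2 * K₁ + K₂) * Real.exp 5 * L := by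
    intro z hz
    have hzc := frontier_subset_closure hz
    rw [hclos, mem_reProdIm] at hzc
    rw [hU, frontier_reProdIm, frontier_Ioo (by linarith), frontier_Ioo (by linarith)] at hz
    have hf1 := h₁ z hzc.1.1 (by linarith [hzc.1.2]) (by linarith [hzc.2.1])
    have hf2 : ‖deriv riemannZeta z / riemannZeta z‖ ≤ 2 * K₁ * Real.exp L :=
      hf1.trans (by nlinarith [hlog2 z hzc.2])
    have hu1 := hzc.1.1
    have hu2 := hzc.1.2
    have husq : (z.re - s.re) ^ 2 ≤ 1 := by
      rw [sq_le_one_iff_abs_le_one, abs_le]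
      constructor <;> linarith
    have hu4 : 4 * L * (z.re - s.re) ≤ 4 := by nlinarith
    have hweak : 2 * K₁ * Real.exp 5 ≤ (2 * K₁ + K₂) * Real.exp 5 * L := by
      have := Real.exp_pos 5
      nlinarith [mul_pos hK₁ this, mul_pos hK₂ this, mul_pos (mul_pos hK₂ this) hL0]
    rw [hnormg]
    have hsmall : (z.re - s.re) ^ 2 - (z.im - s.im) ^ 2 + 4 * L * (z.re - s.re) ≤ 5 - L →
        ‖deriv riemannZeta z / riemannZeta z‖ *
          Real.exp ((z.re - s.re) ^ 2 - (z.im - s.im) ^ 2 + 4 * L * (z.re - s.re)) ≤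
            (2 * K₁ + K₂) * Real.exp 5 * L := fun h ↦ by
      refine le_trans ?_ hweak
      calc _ ≤ 2 * K₁ * Real.exp L * Real.exp (5 - L) := by gcongr
        _ = _ := by rw [mul_assoc, ← Real.exp_add]; ring_nf
    rcases hz with ⟨-, hz⟩ | ⟨hz, -⟩
    · refine hsmall ?_
      have : (z.im - s.im) ^ 2 = L ^ 2 := by
        rcases hz with hz | hz <;> rw [hz] <;> ring
      nlinarith
    · rcases hz with hz | hz
      · refine hsmall ?_
        nlinarith [sq_nonneg (z.im - s.im)]
      · have hz' : z.re = 1 + 1 / L := hz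
        have hf3 := h₂ z (by linarith) (by linarith)
        rw [show z.re - 1 = 1 / L by linarith, div_div_eq_mul_div, div_one] at hf3
        have h5 : (z.re - s.re) ^ 2 - (z.im - s.im) ^ 2 + 4 * L * (z.re - s.re) ≤ 5 := by
          nlinarith [sq_nonneg (z.im - s.im)]
        calc _ ≤ K₂ * L * Real.exp 5 := by gcongr
          _ ≤ _ := by nlinarith [mul_pos (mul_pos hK₁ (Real.exp_pos 5)) hL0]
  have hmem : s ∈ closure U := by
    rw [hclos, mem_reProdIm]
    exact ⟨⟨by linarith, hs2⟩, ⟨by linarith, by linarith⟩⟩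
  have := norm_le_of_forall_mem_frontier_norm_le hbdd hd hfr hmem
  rw [hnormg] at this
  simpa using this

theorem exists_norm_logDeriv_riemannZeta_le_log_log (hRH : RiemannHypothesis) :
    ∃ K > 0, ∃ t₀ : ℝ, ∀ s : ℂ, 1 ≤ s.re → s.re ≤ 2 → t₀ ≤ s.im →
      ‖deriv riemannZeta s / riemannZeta s‖ ≤ K * Real.log (Real.log s.im) := by
  obtain ⟨K₁, hK₁, h₁⟩ := exists_norm_logDeriv_riemannZeta_le_log hRH
  obtain ⟨K₂, hK₂, h₂⟩ := exists_norm_logDeriv_riemannZeta_le_inv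
  have hll := tendsto_log_atTop.comp tendsto_log_atTop
  have hev : ∀ᶠ t : ℝ in atTop, 2 ≤ Real.log (Real.log t) ∧ 1 ≤ Real.log t ∧
      Real.log (Real.log t) + 4 ≤ t := by
    filter_upwards [hll.eventually_ge_atTop 2, tendsto_log_atTop.eventually_ge_atTop 5,
      eventually_ge_atTop 1] with t h3 h4 h5
    refine ⟨h3, by linarith, ?_⟩
    have h6 : Real.log (Real.log t) ≤ Real.log t - 1 := Real.log_le_sub_one_of_pos (by linarith)
    have h8 := Real.add_one_le_exp (Real.log t / 2)
    have h9 : Real.exp (Real.log t / 2) * Real.exp (Real.log t / 2) = t := by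
      rw [← Real.exp_add, add_halves, Real.exp_log (by linarith)]
    nlinarith
  obtain ⟨t₀, ht₀⟩ := eventually_atTop.mp hev
  refine ⟨(2 * K₁ + K₂) * Real.exp 5 + K₂, by positivity, t₀, fun s hs1 hs2 hs3 ↦ ?_⟩
  obtain ⟨h3, h4, h5⟩ := ht₀ _ hs3
  set L := Real.log (Real.log s.im) with hL
  have hE : 0 < (2 * K₁ + K₂) * Real.exp 5 * L := by positivity
  have hKL : 0 < K₂ * L := by positivity
  rw [add_mul]
  rcases le_total s.re (1 + 1 / L) with h | h
  · have := norm_logDeriv_riemannZeta_le_of_strip_bounds hK₁ hK₂ h₁ h₂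
      (fun s hs hs1 ↦ riemannZeta_ne_zero_of_half_lt_re hRH hs hs1) h3 hs1 h hL.symm h5 h4
    linarith
  · have hη : 0 < 1 / L := by positivity
    have h6 : K₂ / (s.re - 1) ≤ K₂ / (1 / L) := by
      gcongr
      linarith
    rw [div_div_eq_mul_div, div_one] at h6
    linarith [h₂ s (by linarith) hs2]

theorem exists_norm_riemannZeta_one_le_mul (hRH : RiemannHypothesis) :
    ∃ A > 0, ∃ t₀ : ℝ, ∀ t η : ℝ, t₀ ≤ t → 0 ≤ η → η ≤ 1 → η * Real.log (Real.log t) ≤ 2 →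
      ‖riemannZeta (1 + t * I)‖ ≤ A * ‖riemannZeta (((1 + η : ℝ) : ℂ) + t * I)‖ := by
  obtain ⟨K, hK, t₀, h⟩ := exists_norm_logDeriv_riemannZeta_le_log_log hRH
  refine ⟨Real.exp (2 * K), by positivity, max t₀ 1, fun t η ht hη0 hη1 hη ↦ ?_⟩
  have ht1 : 1 ≤ t := le_of_max_le_right ht
  have hne1 : ∀ x : ℝ, ((1 + η - x : ℝ) : ℂ) + t * I ≠ 1 := fun x hx ↦ by
    have := congrArg Complex.im hx
    simp at this
    linarith
  have hder : ∀ x : ℝ, HasDerivAt (fun x : ℝ ↦ riemannZeta (((1 + η - x : ℝ) : ℂ) + t * I))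
      (-deriv riemannZeta (((1 + η - x : ℝ) : ℂ) + t * I)) x := fun x ↦ by
    have h1 : HasDerivAt (fun x : ℝ ↦ ((1 + η - x : ℝ) : ℂ) + t * I) (-1) x := by
      have := (((hasDerivAt_id x).const_sub (1 + η)).ofReal_comp).add_const ((t : ℂ) * I)
      simpa using this
    refine ((differentiableAt_riemannZeta (hne1 x)).hasDerivAt.scomp x h1).congr_deriv ?_
    simp
  have key := norm_le_gronwallBound_of_norm_deriv_right_le
    (f := fun x : ℝ ↦ riemannZeta (((1 + η - x : ℝ) : ℂ) + t * I))
    (f' := fun x : ℝ ↦ -deriv riemannZeta (((1 + η - x : ℝ) : ℂ) + t * I))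
    (a := 0) (b := η) (K := K * Real.log (Real.log t)) (ε := 0)
    (fun x _ ↦ (hder x).continuousAt.continuousWithinAt)
    (fun x _ ↦ (hder x).hasDerivWithinAt) le_rfl
    (fun x hx ↦ by
      have h1 := h (((1 + η - x : ℝ) : ℂ) + t * I) (by simp; linarith [hx.2])
        (by simp; linarith [hx.1]) (by simpa using le_of_max_le_left ht)
      have h2 : riemannZeta (((1 + η - x : ℝ) : ℂ) + t * I) ≠ 0 :=
        riemannZeta_ne_zero_of_one_le_re (by simp; linarith [hx.2])
      rw [norm_div, div_le_iff₀ (norm_pos_iff.mpr h2)] at h1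
      simpa using h1) η ⟨hη0, le_rfl⟩
  simp only [gronwallBound_ε0, sub_zero, add_sub_cancel_right, ofReal_one] at key
  refine key.trans ?_
  rw [mul_comm]
  gcongr ?_ * _
  rw [Real.exp_le_exp]
  nlinarith

/-- Against the measure `W`, every translate of every modulation of `G` has an integral at most
the corresponding untranslated one. -/
structure IsShiftDominated (W : Measure ℝ) (G : ℝ → ℂ) : Prop where
  continuous : Continuous G
  bounded : ∃ B, ∀ t, ‖G t‖ ≤ B
  norm_integral_le : ∀ r T : ℝ, ‖∫ t, Complex.exp (r * t * I) * G (t + T) ∂W‖ ≤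
    (∫ t, Complex.exp (r * t * I) * G t ∂W).re

/-- Multiplication by `H` preserves `IsShiftDominated W`. -/
structure IsShiftMultiplier (W : Measure ℝ) (H : ℝ → ℂ) : Prop where
  continuous : Continuous H
  bounded : ∃ B, ∀ t, ‖H t‖ ≤ B
  mul_isShiftDominated : ∀ G, IsShiftDominated W G → IsShiftDominated W fun t ↦ H t * G t

theorem norm_exp_mul_mul_I (r t : ℝ) : ‖Complex.exp (r * t * I)‖ = 1 := by
  exact_mod_cast Complex.norm_exp_ofReal_mul_I (r * t)

section

variable {W : Measure ℝ}

theorem integrable_exp_mul_of_bounded [IsFiniteMeasure W] {G : ℝ → ℂ} (hG : Continuous G) {B : ℝ}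
    (hB : ∀ t, ‖G t‖ ≤ B) (r T : ℝ) :
    Integrable (fun t : ℝ ↦ Complex.exp (r * t * I) * G (t + T)) W := by
  refine Integrable.of_bound (C := B) ?_ (Eventually.of_forall fun t ↦ ?_)
  · exact (by fun_prop : Continuous fun t : ℝ ↦ Complex.exp (r * t * I) * G (t + T)).aestronglyMeasurable
  · rw [norm_mul, norm_exp_mul_mul_I, one_mul]
    exact hB _

theorem hasSum_integral_exp_mul [IsFiniteMeasure W] {ι : Type*} [Countable ι] {G : ι → ℝ → ℂ} {b : ι → ℝ}
    (hb : Summable b) (hGb : ∀ i t, ‖G i t‖ ≤ b i) (hG : ∀ i, Continuous (G i)) (r T : ℝ) :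
    HasSum (fun i ↦ ∫ t, Complex.exp (r * t * I) * G i (t + T) ∂W)
      (∫ t, Complex.exp (r * t * I) * ∑' i, G i (t + T) ∂W) := by
  have hint := fun i ↦ integrable_exp_mul_of_bounded (W := W) (hG i) (hGb i) r T
  have h := hasSum_integral_of_summable_integral_norm hint ?_
  · simpa only [tsum_mul_left] using h
  · refine Summable.of_nonneg_of_le (fun i ↦ integral_nonneg fun t ↦ norm_nonneg _) (fun i ↦ ?_)
      (hb.mul_right (W.real Set.univ))
    calc ∫ t, ‖Complex.exp (r * t * I) * G i (t + T)‖ ∂W ≤ ∫ _, b i ∂W := by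
          refine integral_mono (hint i).norm (integrable_const _) fun t ↦ ?_
          simp only [norm_mul, norm_exp_mul_mul_I, one_mul]
          exact hGb i _
      _ = _ := by simp [mul_comm]

theorem IsShiftDominated.tsum [IsFiniteMeasure W] {ι : Type*} [Countable ι] {G : ι → ℝ → ℂ} {b : ι → ℝ}
    (hb : Summable b) (hGb : ∀ i t, ‖G i t‖ ≤ b i) (hG : ∀ i, IsShiftDominated W (G i)) :
    IsShiftDominated W fun t ↦ ∑' i, G i t where
  continuous := continuous_tsum (fun i ↦ (hG i).continuous) hb hGb
  bounded := ⟨∑' i, b i, fun t ↦ tsum_of_norm_bounded hb.hasSum (hGb · t)⟩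
  norm_integral_le r T := by
    have h1 := hasSum_integral_exp_mul (W := W) hb hGb (fun i ↦ (hG i).continuous) r T
    have h2 := hasSum_integral_exp_mul (W := W) hb hGb (fun i ↦ (hG i).continuous) r 0
    simp only [add_zero] at h2
    rw [← h1.tsum_eq]
    exact tsum_of_norm_bounded (hasSum_re h2) fun i ↦ (hG i).norm_integral_le r T

theorem IsShiftDominated.add [IsFiniteMeasure W] {G₁ G₂ : ℝ → ℂ} (h₁ : IsShiftDominated W G₁)
    (h₂ : IsShiftDominated W G₂) : IsShiftDominated W fun t ↦ G₁ t + G₂ t := by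
  obtain ⟨B₁, hB₁⟩ := h₁.bounded
  obtain ⟨B₂, hB₂⟩ := h₂.bounded
  refine ⟨h₁.continuous.add h₂.continuous,
    ⟨B₁ + B₂, fun t ↦ (norm_add_le _ _).trans (add_le_add (hB₁ t) (hB₂ t))⟩, fun r T ↦ ?_⟩
  have e₁ := integrable_exp_mul_of_bounded (W := W) h₁.continuous hB₁ r
  have e₂ := integrable_exp_mul_of_bounded (W := W) h₂.continuous hB₂ r
  have f₁ := e₁ 0
  have f₂ := e₂ 0
  simp only [add_zero] at f₁ f₂
  simp only [mul_add]
  rw [integral_add (e₁ T) (e₂ T), integral_add f₁ f₂, add_re]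
  exact (norm_add_le _ _).trans (add_le_add (h₁.norm_integral_le r T) (h₂.norm_integral_le r T))

theorem IsShiftMultiplier.const_mul_exp {c : ℝ} (hc : 0 ≤ c) (l : ℝ) :
    IsShiftMultiplier W fun t ↦ c * Complex.exp (l * t * I) where
  continuous := by fun_prop
  bounded := ⟨c, fun t ↦ by
    rw [norm_mul, norm_exp_mul_mul_I, Complex.norm_real, Real.norm_of_nonneg hc, mul_one]⟩
  mul_isShiftDominated G hG := by
    obtain ⟨B, hB⟩ := hG.bounded
    have hGc := hG.continuous
    refine ⟨by fun_prop, ⟨c * B, fun t ↦ ?_⟩, fun r T ↦ ?_⟩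
    · rw [norm_mul, norm_mul, norm_exp_mul_mul_I, Complex.norm_real, Real.norm_of_nonneg hc, mul_one]
      gcongr
      exact hB t
    · have h (T : ℝ) : ∫ t, Complex.exp (r * t * I) *
            (c * Complex.exp (l * (t + T : ℝ) * I) * G (t + T)) ∂W =
          c * Complex.exp (l * T * I) * ∫ t, Complex.exp ((r + l : ℝ) * t * I) * G (t + T) ∂W := by
        rw [← MeasureTheory.integral_const_mul]
        refine integral_congr_ae (Eventually.of_forall fun t ↦ ?_)
        have : Complex.exp ((r + l : ℝ) * t * I) * Complex.exp (l * T * I) =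
            Complex.exp (r * t * I) * Complex.exp (l * (t + T : ℝ) * I) := by
          rw [← Complex.exp_add, ← Complex.exp_add]
          push_cast
          ring_nf
        simp only
        linear_combination (-(c : ℂ) * G (t + T)) * this
      have h0 := h 0
      simp only [add_zero, ofReal_zero, mul_zero, zero_mul, Complex.exp_zero, mul_one] at h0
      rw [h, h0, norm_mul, norm_mul, norm_exp_mul_mul_I, Complex.norm_real, Real.norm_of_nonneg hc,
        mul_one, re_ofReal_mul]
      gcongr
      exact hG.norm_integral_le _ _

theorem IsShiftMultiplier.add [IsFiniteMeasure W] {H₁ H₂ : ℝ → ℂ} (h₁ : IsShiftMultiplier W H₁)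
    (h₂ : IsShiftMultiplier W H₂) : IsShiftMultiplier W fun t ↦ H₁ t + H₂ t := by
  obtain ⟨B₁, hB₁⟩ := h₁.bounded
  obtain ⟨B₂, hB₂⟩ := h₂.bounded
  refine ⟨h₁.continuous.add h₂.continuous,
    ⟨B₁ + B₂, fun t ↦ (norm_add_le _ _).trans (add_le_add (hB₁ t) (hB₂ t))⟩, fun G hG ↦ ?_⟩
  simp only [add_mul]
  exact (h₁.mul_isShiftDominated G hG).add (h₂.mul_isShiftDominated G hG)

theorem IsShiftMultiplier.mul {H₁ H₂ : ℝ → ℂ} (h₁ : IsShiftMultiplier W H₁)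
    (h₂ : IsShiftMultiplier W H₂) : IsShiftMultiplier W fun t ↦ H₁ t * H₂ t := by
  obtain ⟨B₁, hB₁⟩ := h₁.bounded
  obtain ⟨B₂, hB₂⟩ := h₂.bounded
  refine ⟨h₁.continuous.mul h₂.continuous, ⟨B₁ * B₂, fun t ↦ ?_⟩, fun G hG ↦ ?_⟩
  · rw [norm_mul]
    exact mul_le_mul (hB₁ t) (hB₂ t) (norm_nonneg _) ((norm_nonneg _).trans (hB₁ t))
  · simp only [mul_assoc]
    exact h₁.mul_isShiftDominated _ (h₂.mul_isShiftDominated G hG)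

theorem IsShiftMultiplier.const {c : ℝ} (hc : 0 ≤ c) :
    IsShiftMultiplier W fun _ ↦ (c : ℂ) := by
  simpa using IsShiftMultiplier.const_mul_exp (W := W) hc 0

theorem IsShiftMultiplier.pow {H : ℝ → ℂ} (h : IsShiftMultiplier W H) (n : ℕ) :
    IsShiftMultiplier W fun t ↦ H t ^ n := by
  induction n with
  | zero => simpa using IsShiftMultiplier.const (W := W) zero_le_one
  | succ n ih => simpa only [pow_succ] using ih.mul h

theorem IsShiftMultiplier.tsum [IsFiniteMeasure W] {ι : Type*} [Countable ι] {H : ι → ℝ → ℂ} {b : ι → ℝ}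
    (hb : Summable b) (hHb : ∀ i t, ‖H i t‖ ≤ b i) (hH : ∀ i, IsShiftMultiplier W (H i)) :
    IsShiftMultiplier W fun t ↦ ∑' i, H i t where
  continuous := continuous_tsum (fun i ↦ (hH i).continuous) hb hHb
  bounded := ⟨∑' i, b i, fun t ↦ tsum_of_norm_bounded hb.hasSum (hHb · t)⟩
  mul_isShiftDominated G hG := by
    obtain ⟨B, hB⟩ := hG.bounded
    simp only [← tsum_mul_right]
    refine IsShiftDominated.tsum (hb.mul_right B) (fun i t ↦ ?_)
      fun i ↦ (hH i).mul_isShiftDominated G hG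
    rw [norm_mul]
    exact mul_le_mul (hHb i t) (hB t) (norm_nonneg _) ((norm_nonneg _).trans (hHb i t))

theorem IsShiftMultiplier.exp [IsFiniteMeasure W] {H : ℝ → ℂ} (h : IsShiftMultiplier W H) :
    IsShiftMultiplier W fun t ↦ Complex.exp (H t) := by
  obtain ⟨B, hB⟩ := h.bounded
  have heq : (fun t ↦ Complex.exp (H t)) =
      fun t ↦ ∑' n : ℕ, (((n.factorial : ℝ)⁻¹ : ℝ) : ℂ) * H t ^ n := by
    ext t
    rw [Complex.exp_eq_exp_ℂ, NormedSpace.exp_eq_tsum_div]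
    refine tsum_congr fun n ↦ ?_
    push_cast
    rw [div_eq_inv_mul]
  rw [heq]
  refine IsShiftMultiplier.tsum (Real.summable_pow_div_factorial B) (fun n t ↦ ?_)
    fun n ↦ (IsShiftMultiplier.const (by positivity)).mul (h.pow n)
  rw [norm_mul, norm_pow, Complex.norm_real, Real.norm_of_nonneg (by positivity), div_eq_inv_mul]
  gcongr
  exact hB t

theorem IsShiftMultiplier.norm_riemannZeta_rpow [IsFiniteMeasure W] {σ : ℝ} (hσ : 1 < σ) {p : ℝ} (hp : 0 ≤ p) :
    IsShiftMultiplier W fun t ↦ ((‖riemannZeta (σ + t * I)‖ ^ p : ℝ) : ℂ) := by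
  set z : Nat.Primes → ℝ → ℂ := fun q t ↦ ((q : ℕ) : ℂ) ^ (-(σ + t * I)) with hz
  have hq (q : Nat.Primes) : (0 : ℝ) < (q : ℕ) := by exact_mod_cast q.2.pos
  have hzexp (q : Nat.Primes) (t : ℝ) : z q t =
      (((q : ℕ) : ℝ) ^ (-σ) : ℝ) * Complex.exp ((-Real.log (q : ℕ) : ℝ) * t * I) := by
    have hq0 : ((q : ℕ) : ℂ) ≠ 0 := by exact_mod_cast (hq q).ne'
    rw [hz, Real.rpow_def_of_pos (hq q), ofReal_exp, ← Complex.exp_add]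
    simp only
    rw [cpow_def_of_ne_zero hq0, ← ofReal_natCast, ← ofReal_log (hq q).le]
    push_cast
    ring_nf
  have hznorm (q : Nat.Primes) (t : ℝ) : ‖z q t‖ = ((q : ℕ) : ℝ) ^ (-σ) := by
    rw [hzexp, norm_mul, norm_exp_mul_mul_I, mul_one, Complex.norm_real,
      Real.norm_of_nonneg (by positivity)]
  have hhalf (q : Nat.Primes) : ((q : ℕ) : ℝ) ^ (-σ) ≤ 1 / 2 := by
    have h2 : (2 : ℝ) ≤ (q : ℕ) := by exact_mod_cast q.2.two_le
    calc ((q : ℕ) : ℝ) ^ (-σ) ≤ ((q : ℕ) : ℝ) ^ (-1 : ℝ) :=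
          Real.rpow_le_rpow_of_exponent_le (by linarith) (by linarith)
      _ = ((q : ℕ) : ℝ)⁻¹ := Real.rpow_neg_one _
      _ ≤ 1 / 2 := by rw [inv_le_comm₀ (hq q) (by norm_num)]; linarith
  have hzm (q : Nat.Primes) : IsShiftMultiplier W (z q) := by
    have := IsShiftMultiplier.const_mul_exp (W := W)
      (c := ((q : ℕ) : ℝ) ^ (-σ)) (by positivity) (-Real.log (q : ℕ))
    rwa [← funext (hzexp q)] at this
  have hzm' (q : Nat.Primes) : IsShiftMultiplier W fun t ↦ (starRingEnd ℂ) (z q t) := by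
    have := IsShiftMultiplier.const_mul_exp (W := W)
      (c := ((q : ℕ) : ℝ) ^ (-σ)) (by positivity) (Real.log (q : ℕ))
    convert this using 2 with t
    rw [hzexp, map_mul, conj_ofReal, ← Complex.exp_conj]
    congr 2
    simp only [map_mul, map_neg, conj_ofReal, conj_I, ofReal_neg]
    ring
  have hgeom (q : Nat.Primes) : Summable fun n : ℕ ↦ (((q : ℕ) : ℝ) ^ (-σ)) ^ n :=
    summable_geometric_of_lt_one (by positivity) (by linarith [hhalf q])
  have hlogm (q : Nat.Primes) (w : ℝ → ℂ) (hw : IsShiftMultiplier W w)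
      (hwn : ∀ t, ‖w t‖ = ((q : ℕ) : ℝ) ^ (-σ)) :
      IsShiftMultiplier W fun t ↦ -Complex.log (1 - w t) := by
    have heq : (fun t ↦ -Complex.log (1 - w t)) =
        fun t ↦ ∑' n : ℕ, (((n : ℝ)⁻¹ : ℝ) : ℂ) * w t ^ n := by
      ext t
      rw [← (hasSum_taylorSeries_neg_log (z := w t) (by rw [hwn]; linarith [hhalf q])).tsum_eq]
      refine tsum_congr fun n ↦ ?_
      push_cast
      rw [div_eq_inv_mul]
    rw [heq]
    refine IsShiftMultiplier.tsum (hgeom q) (fun n t ↦ ?_)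
      fun n ↦ (IsShiftMultiplier.const (by positivity)).mul (hw.pow n)
    rw [norm_mul, norm_pow, hwn, Complex.norm_real, Real.norm_of_nonneg (by positivity)]
    exact mul_le_of_le_one_left (by positivity) (Nat.cast_inv_le_one n)
  have hlogb (q : Nat.Primes) (w : ℂ) (hwn : ‖w‖ = ((q : ℕ) : ℝ) ^ (-σ)) :
      ‖-Complex.log (1 - w)‖ ≤ 3 / 2 * ((q : ℕ) : ℝ) ^ (-σ) := by
    have := Complex.norm_log_one_add_half_le_self (z := -w) (by rw [norm_neg, hwn]; exact hhalf q)
    rwa [norm_neg, hwn, ← sub_eq_add_neg, ← norm_neg] at this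
  have hsum : Summable fun q : Nat.Primes ↦ 3 / 2 * ((q : ℕ) : ℝ) ^ (-σ) :=
    (Nat.Primes.summable_rpow.mpr (by linarith)).mul_left _
  have hL := IsShiftMultiplier.tsum (W := W) hsum (H := fun q t ↦ -Complex.log (1 - z q t))
    (fun q t ↦ hlogb q _ (hznorm q t)) fun q ↦ hlogm q _ (hzm q) (hznorm q)
  have hL' := IsShiftMultiplier.tsum (W := W) hsum
    (H := fun q t ↦ -Complex.log (1 - (starRingEnd ℂ) (z q t)))
    (fun q t ↦ hlogb q _ (by rw [Complex.norm_conj, hznorm]))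
    fun q ↦ hlogm q _ (hzm' q) fun t ↦ by rw [Complex.norm_conj, hznorm]
  have hfin := ((IsShiftMultiplier.const (W := W) (c := p / 2) (by positivity)).mul
    (hL.add hL')).exp
  convert hfin using 2 with t
  have hconj : ∑' q, -Complex.log (1 - (starRingEnd ℂ) (z q t)) =
      (starRingEnd ℂ) (∑' q, -Complex.log (1 - z q t)) := by
    rw [Complex.conj_tsum]
    refine tsum_congr fun q ↦ ?_
    rw [map_neg, ← Complex.log_conj, map_sub, map_one]
    refine fun h ↦ ?_
    have h1 := (Complex.arg_eq_pi_iff.mp h).1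
    have h2 := abs_re_le_norm (z q t)
    rw [hznorm] at h2
    simp only [sub_re, one_re] at h1
    linarith [le_abs_self (z q t).re, hhalf q]
  rw [hconj, Complex.add_conj, ← riemannZeta_eulerProduct_exp_log (s := σ + t * I) (by simpa using hσ),
    Complex.norm_exp, ← Real.exp_mul, ofReal_exp]
  congr 1
  push_cast
  ring

end

theorem isShiftDominated_one_map_sub (ν : Measure ℝ) [IsFiniteMeasure ν] :
    IsShiftDominated ((ν.prod ν).map fun x ↦ x.1 - x.2) fun _ ↦ 1 where
  continuous := continuous_const
  bounded := ⟨1, fun _ ↦ by simp⟩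
  norm_integral_le r T := by
    simp only [mul_one]
    have h : ∫ t, Complex.exp (r * t * I) ∂((ν.prod ν).map fun x ↦ x.1 - x.2) =
        (Complex.normSq (∫ x, Complex.exp (r * x * I) ∂ν) : ℂ) := by
      rw [integral_map (by fun_prop)
        (by fun_prop : Continuous fun t : ℝ ↦ Complex.exp (r * t * I)).aestronglyMeasurable,
        ← Complex.mul_conj, ← integral_conj, ← integral_prod_mul]
      refine integral_congr_ae (Eventually.of_forall fun x ↦ ?_)
      simp only [← Complex.exp_conj, ← Complex.exp_add, map_mul, conj_ofReal, conj_I]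
      push_cast
      ring_nf
    rw [h, Complex.norm_real, ofReal_re, Real.norm_of_nonneg (Complex.normSq_nonneg _)]

theorem intervalIntegral_le_of_isShiftMultiplier {g : ℝ → ℝ} (hg0 : ∀ t, 0 ≤ g t)
    (hg : ∀ (W : Measure ℝ) [IsFiniteMeasure W], IsShiftMultiplier W fun t ↦ (g t : ℂ))
    {δ : ℝ} (hδ : 0 < δ) (T : ℝ) :
    ∫ t in T..T + δ, g t ≤ 2 * ∫ t in -(2 * δ)..2 * δ, g t := by
  have hgc : Continuous g := by
    simpa only [Function.comp_def, ofReal_re] using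
      Complex.continuous_re.comp (hg 0).continuous
  obtain ⟨B, hB⟩ := (hg 0).bounded
  simp only [Complex.norm_real] at hB
  set ν : Measure ℝ := volume.restrict (Set.Ioc 0 (2 * δ)) with hν
  have hii (a b : ℝ) : IntervalIntegrable g volume a b := hgc.intervalIntegrable a b
  have hmono {a b c d : ℝ} (hca : c ≤ a) (hab : a ≤ b) (hbd : b ≤ d) :
      ∫ t in a..b, g t ≤ ∫ t in c..d, g t :=
    integral_mono_interval hca hab hbd (Eventually.of_forall hg0) (hii c d)
  have hinner (S : ℝ) : ∫ t, g (t + S) ∂((ν.prod ν).map fun x ↦ x.1 - x.2) =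
      ∫ x in (0 : ℝ)..2 * δ, ∫ u in (x + S - 2 * δ)..(x + S), g u := by
    have hint : Integrable (fun x : ℝ × ℝ ↦ g (x.1 - x.2 + S)) (ν.prod ν) :=
      Integrable.of_bound (by fun_prop) B (Eventually.of_forall fun _ ↦ hB _)
    rw [integral_map (by fun_prop) (by fun_prop), integral_prod _ hint,
      intervalIntegral.integral_of_le (by positivity)]
    refine integral_congr_ae (Eventually.of_forall fun x ↦ ?_)
    simp only
    rw [hν, ← intervalIntegral.integral_of_le (by positivity)]
    have := intervalIntegral.integral_comp_sub_left (a := 0) (b := 2 * δ) g (x + S)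
    rw [sub_zero] at this
    rw [← this]
    refine intervalIntegral.integral_congr fun y _ ↦ ?_
    ring_nf
  have hcont (S : ℝ) : Continuous fun x ↦ ∫ u in (x + S - 2 * δ)..(x + S), g u := by
    have h := intervalIntegral.continuous_primitive hii 0
    refine ((h.comp (by fun_prop : Continuous fun x ↦ x + S)).sub
      (h.comp (by fun_prop : Continuous fun x ↦ x + S - 2 * δ))).congr fun x ↦ ?_
    exact integral_interval_sub_left (hii 0 (x + S)) (hii 0 (x + S - 2 * δ))
  have hkey := ((hg _).mul_isShiftDominated _ (isShiftDominated_one_map_sub ν)).norm_integral_le 0 T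
  simp only [ofReal_zero, zero_mul, Complex.exp_zero, one_mul, mul_one] at hkey
  rw [integral_complex_ofReal, integral_complex_ofReal, Complex.norm_real, ofReal_re] at hkey
  replace hkey := (le_abs_self _).trans hkey
  have h0 := hinner 0
  simp only [add_zero] at h0
  rw [hinner, h0] at hkey
  have hlow : δ * ∫ t in T..T + δ, g t ≤
      ∫ x in (0 : ℝ)..2 * δ, ∫ u in (x + T - 2 * δ)..(x + T), g u := by
    calc δ * ∫ t in T..T + δ, g t = ∫ x in δ..2 * δ, ∫ t in T..T + δ, g t := by
          rw [intervalIntegral.integral_const, smul_eq_mul]; ring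
      _ ≤ ∫ x in δ..2 * δ, ∫ u in (x + T - 2 * δ)..(x + T), g u := by
          refine integral_mono_on (by linarith) (by simp) ((hcont T).intervalIntegrable _ _)
            fun x hx ↦ hmono ?_ ?_ ?_ <;> linarith [hx.1, hx.2]
      _ ≤ _ := by
          refine integral_mono_interval hδ.le (by linarith) le_rfl
            (Eventually.of_forall fun x ↦ ?_) ((hcont T).intervalIntegrable _ _)
          exact intervalIntegral.integral_nonneg (by linarith) fun u _ ↦ hg0 u
  have hupp : ∫ x in (0 : ℝ)..2 * δ, ∫ u in (x - 2 * δ)..x, g u ≤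
      2 * δ * ∫ t in -(2 * δ)..2 * δ, g t := by
    calc _ ≤ ∫ x in (0 : ℝ)..2 * δ, ∫ t in -(2 * δ)..2 * δ, g t := by
          refine integral_mono_on (by linarith) ?_ (by simp)
            fun x hx ↦ hmono ?_ ?_ ?_
          · simpa using (hcont 0).intervalIntegrable (μ := volume) 0 (2 * δ)
          all_goals linarith [hx.1, hx.2]
      _ = _ := by rw [intervalIntegral.integral_const, smul_eq_mul]; ring
  refine le_of_mul_le_mul_left ?_ hδ
  linarith

theorem exists_norm_riemannZeta_le_div (a : ℝ) :
    ∃ C > 0, ∀ η t : ℝ, 0 < η → η ≤ 1 → |t| ≤ a →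
      ‖riemannZeta ((1 + η : ℝ) + t * I)‖ ≤ C * ‖(η : ℂ) + t * I‖⁻¹ := by
  obtain ⟨C, hC, h⟩ := exists_norm_riemannZeta_le
  refine ⟨1 + C * (2 + |a|) * (1 + |a|), by positivity, fun η t hη hη1 ht ↦ ?_⟩
  have hw : (((1 + η : ℝ) : ℂ) + t * I) - 1 = η + t * I := by push_cast; ring
  have hre : (((1 + η : ℝ) : ℂ) + t * I).re = 1 + η := by simp
  have hw0 : (η : ℂ) + t * I ≠ 0 := fun h0 ↦ by
    have := congrArg Complex.re h0
    simp at this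
    exact hη.ne' this
  have hne : ((1 + η : ℝ) : ℂ) + t * I ≠ 1 := by
    rw [← sub_ne_zero, hw]
    exact hw0
  have h1 := h _ (by rw [hre]; linarith) hne
  rw [hw] at h1
  have hta : |t| ≤ |a| := ht.trans (le_abs_self a)
  have hn : ‖(η : ℂ) + t * I‖ ≤ 1 + |a| := by
    refine (norm_add_le _ _).trans (add_le_add ?_ ?_)
    · rw [Complex.norm_real, Real.norm_of_nonneg hη.le]; exact hη1
    · simpa using hta
  have hs : ‖((1 + η : ℝ) : ℂ) + t * I‖ ≤ 2 + |a| := by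
    refine (norm_add_le _ _).trans (add_le_add ?_ ?_)
    · rw [Complex.norm_real, Real.norm_of_nonneg (by linarith)]; linarith
    · simpa using hta
  have hpos : 0 < ‖(η : ℂ) + t * I‖ := norm_pos_iff.mpr hw0
  calc _ ≤ _ := h1
    _ ≤ ‖(η : ℂ) + t * I‖⁻¹ + C * (2 + |a|) * 1 := by
        rw [mul_one]; gcongr
    _ ≤ ‖(η : ℂ) + t * I‖⁻¹ + C * (2 + |a|) * ((1 + |a|) * ‖(η : ℂ) + t * I‖⁻¹) := by
        gcongr
        rw [← div_eq_mul_inv, one_le_div hpos]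
        exact hn
    _ = _ := by ring

theorem exists_integral_norm_riemannZeta_rpow_le {p : ℝ} (hp : 1 < p) {a : ℝ} (ha : 0 < a) :
    ∃ C > 0, ∀ η : ℝ, 0 < η → η ≤ 1 →
      ∫ t in -a..a, ‖riemannZeta ((1 + η : ℝ) + t * I)‖ ^ p ≤ C * η ^ (1 - p) := by
  obtain ⟨C, hC, h⟩ := exists_norm_riemannZeta_le_div a
  have hJ : Integrable fun u : ℝ ↦ (1 + ‖u‖ ^ 2) ^ (-p / 2) :=
    integrable_rpow_neg_one_add_norm_sq (by simpa using hp)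
  set J := ∫ u : ℝ, (1 + ‖u‖ ^ 2) ^ (-p / 2) with hJdef
  have hJ0 : 0 ≤ J := integral_nonneg fun u ↦ by positivity
  refine ⟨C ^ p * (J + 1), by positivity, fun η hη hη1 ↦ ?_⟩
  have hpt (t : ℝ) (ht : |t| ≤ a) : ‖riemannZeta ((1 + η : ℝ) + t * I)‖ ^ p ≤
      C ^ p * η ^ (-p) * (1 + ‖t / η‖ ^ 2) ^ (-p / 2) := by
    have hn : ‖(η : ℂ) + t * I‖⁻¹ = η⁻¹ * (1 + ‖t / η‖ ^ 2) ^ (-(1 / 2) : ℝ) := by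
      rw [Complex.norm_add_mul_I, Real.rpow_neg (by positivity), ← Real.sqrt_eq_rpow, ← mul_inv]
      congr 1
      rw [show η ^ 2 + t ^ 2 = η ^ 2 * (1 + ‖t / η‖ ^ 2) by
        rw [Real.norm_eq_abs, sq_abs]; field_simp, Real.sqrt_mul (by positivity),
        Real.sqrt_sq hη.le]
    calc _ ≤ (C * ‖(η : ℂ) + t * I‖⁻¹) ^ p := by
          gcongr
          exact h η t hη hη1 ht
      _ = _ := by
          rw [hn, Real.mul_rpow hC.le (by positivity), Real.mul_rpow (by positivity) (by positivity),
            ← Real.rpow_mul (by positivity), Real.inv_rpow hη.le, ← Real.rpow_neg hη.le, mul_assoc]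
          ring_nf
  have hJη : Integrable fun t : ℝ ↦ (1 + ‖t / η‖ ^ 2) ^ (-p / 2) := hJ.comp_div hη.ne'
  have hcont : Continuous fun t : ℝ ↦ ‖riemannZeta ((1 + η : ℝ) + t * I)‖ ^ p := by
    have := Complex.continuous_re.comp (IsShiftMultiplier.norm_riemannZeta_rpow (W := 0)
      (σ := 1 + η) (by linarith) (p := p) (by linarith)).continuous
    simpa only [Function.comp_def, ofReal_re] using this
  calc _ ≤ ∫ t in -a..a, C ^ p * η ^ (-p) * (1 + ‖t / η‖ ^ 2) ^ (-p / 2) :=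
        integral_mono_on (by linarith) (hcont.intervalIntegrable _ _)
          (hJη.const_mul _).intervalIntegrable fun t ht ↦ hpt t (abs_le.mpr ht)
    _ = C ^ p * η ^ (-p) * ∫ t in -a..a, (1 + ‖t / η‖ ^ 2) ^ (-p / 2) := by
        rw [intervalIntegral.integral_const_mul]
    _ ≤ C ^ p * η ^ (-p) * ∫ t : ℝ, (1 + ‖t / η‖ ^ 2) ^ (-p / 2) := by
        rw [intervalIntegral.integral_of_le (by linarith)]
        exact mul_le_mul_of_nonneg_left
          (setIntegral_le_integral hJη (Eventually.of_forall fun t ↦ by positivity)) (by positivity)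
    _ = C ^ p * η ^ (-p) * (η * J) := by
        rw [Measure.integral_comp_div (fun u : ℝ ↦ (1 + ‖u‖ ^ 2) ^ (-p / 2)) η, abs_of_pos hη,
          smul_eq_mul]
    _ = C ^ p * J * η ^ (1 - p) := by
        rw [sub_eq_neg_add, Real.rpow_add hη, Real.rpow_one]; ring
    _ ≤ _ := by
        gcongr
        linarith

theorem exists_integral_norm_riemannZeta_rpow_le_mul {p : ℝ} (hp : 1 < p) {δ : ℝ} (hδ : 0 < δ) :
    ∃ C > 0, ∀ η T : ℝ, 0 < η → η ≤ 1 →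
      ∫ t in T..T + δ, ‖riemannZeta ((1 + η : ℝ) + t * I)‖ ^ p ≤ C * η ^ (1 - p) := by
  obtain ⟨C, hC, h⟩ := exists_integral_norm_riemannZeta_rpow_le hp (a := 2 * δ) (by positivity)
  refine ⟨2 * C, by positivity, fun η T hη hη1 ↦ ?_⟩
  have := intervalIntegral_le_of_isShiftMultiplier
    (g := fun t ↦ ‖riemannZeta ((1 + η : ℝ) + t * I)‖ ^ p) (fun t ↦ by positivity)
    (fun W _ ↦ IsShiftMultiplier.norm_riemannZeta_rpow (by linarith) (by linarith)) hδ T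
  linarith [h η hη hη1]

theorem stmt_12 (hRH : RiemannHypothesis) (p : ℝ) (hp : 1 < p) (δ : ℝ) (hδ : 0 < δ) :
    ∃ C > (0 : ℝ), ∃ T₀ : ℝ, (16 : ℝ) ≤ T₀ ∧ ∀ T : ℝ, T₀ ≤ T →
      (∫ t in T..(T + δ), ‖riemannZeta (1 + t * Complex.I)‖ ^ (p)) ≤ C * Real.log (Real.log (Real.log T)) * Real.log (Real.log T) ^ (p - 1) := by
  obtain ⟨A, hA, t₀, hAζ⟩ := exists_norm_riemannZeta_one_le_mul hRH
  obtain ⟨C, hC, hCζ⟩ := exists_integral_norm_riemannZeta_rpow_le_mul hp hδ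
  have hlll : Tendsto (fun T ↦ Real.log (Real.log (Real.log T))) atTop atTop :=
    tendsto_log_atTop.comp (tendsto_log_atTop.comp tendsto_log_atTop)
  have hll : Tendsto (fun T ↦ Real.log (Real.log T)) atTop atTop :=
    tendsto_log_atTop.comp tendsto_log_atTop
  obtain ⟨T₁, hT₁⟩ := eventually_atTop.mp
    ((hlll.eventually_ge_atTop 1).and (hll.eventually_ge_atTop 1))
  refine ⟨A ^ p * C, by positivity, max 16 (max t₀ (max δ T₁)), le_max_left _ _, fun T hT ↦ ?_⟩
  simp only [max_le_iff] at hT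
  obtain ⟨hT16, hTt, hTδ, hTT⟩ := hT
  obtain ⟨h3, h2⟩ := hT₁ T hTT
  set L := Real.log (Real.log T) with hL
  have hL0 : 0 < L := by linarith
  have hlogT : 0 < Real.log T := Real.log_pos (by linarith)
  have hpt (t : ℝ) (ht : t ∈ Set.Icc T (T + δ)) : ‖riemannZeta (1 + t * I)‖ ^ p ≤
      A ^ p * ‖riemannZeta ((1 + L⁻¹ : ℝ) + t * I)‖ ^ p := by
    rw [← Real.mul_rpow hA.le (norm_nonneg _)]
    refine Real.rpow_le_rpow (norm_nonneg _)
      (hAζ t L⁻¹ (hTt.trans ht.1) (by positivity) (inv_le_one_of_one_le₀ h2) ?_) (by linarith)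
    have hlog : Real.log (Real.log t) ≤ Real.log 2 + L := by
      rw [hL, ← Real.log_mul two_ne_zero hlogT.ne']
      refine Real.log_le_log (Real.log_pos (by linarith [ht.1])) ?_
      calc Real.log t ≤ Real.log (T ^ 2) :=
            Real.log_le_log (by linarith [ht.1]) (by nlinarith [ht.2])
        _ = _ := by rw [Real.log_pow]; norm_num
    rw [inv_mul_le_iff₀ hL0]
    linarith [Real.log_two_lt_d9]
  have hL1 : L⁻¹ ≤ 1 := inv_le_one_of_one_le₀ h2
  have hz {σ t : ℝ} (h : (σ : ℂ) + t * I ≠ 1) : ContinuousAt (fun t : ℝ ↦ ‖riemannZeta (σ + t * I)‖ ^ p) t := by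
    have h1 : ContinuousAt (fun t : ℝ ↦ riemannZeta (σ + t * I)) t :=
      (differentiableAt_riemannZeta h).continuousAt.comp
        (f := fun t : ℝ ↦ (σ : ℂ) + t * I) (by fun_prop)
    exact h1.norm.rpow_const (Or.inr (by linarith))
  have hint (σ : ℝ) : IntervalIntegrable (fun t : ℝ ↦ ‖riemannZeta (σ + t * I)‖ ^ p) volume T
      (T + δ) := by
    refine ContinuousOn.intervalIntegrable_of_Icc (by linarith) fun t ht ↦
      (hz fun h ↦ ?_).continuousWithinAt
    have := congrArg Complex.im h
    simp at this
    linarith [ht.1]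
  calc _ ≤ ∫ t in T..T + δ, A ^ p * ‖riemannZeta ((1 + L⁻¹ : ℝ) + t * I)‖ ^ p :=
        integral_mono_on (by linarith) (by simpa using hint 1) ((hint _).const_mul _) hpt
    _ = A ^ p * ∫ t in T..T + δ, ‖riemannZeta ((1 + L⁻¹ : ℝ) + t * I)‖ ^ p := by
        rw [intervalIntegral.integral_const_mul]
    _ ≤ A ^ p * (C * L⁻¹ ^ (1 - p)) := by
        gcongr
        exact hCζ _ T (by positivity) hL1
    _ = A ^ p * C * 1 * L ^ (p - 1) := by
        rw [Real.inv_rpow hL0.le, ← Real.rpow_neg hL0.le, neg_sub]; ring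
    _ ≤ _ := by gcongr
end
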